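/- arXiv:1711.00776 — 5 statements merged into one kernel-verified Lean document; each statement's English description precedes it below -/
import Mathlib

section
/- Let v ∈ C⁴(ℝ) be a solution of the ODE v'''' − A·v'' − f(v) = 0 on ℝ. Then v(t) does not tend to +∞ and does not tend to −∞ as t → ∞; in particular, if the limit of v(t) as t → ∞ exists in ℝ ∪ {±∞}, it is a finite real number. The same holds as t → −∞. -/
open Real Filter

namespace Paper

/-- The coefficient `A = (n(n-4)+8)/2`. -/
noncomputable def A (n : ℕ) : ℝ := ((n : ℝ) * ((n : ℝ) - 4) + 8) / 2

/-- The coefficient `B = n²(n-4)²/16`. -/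
noncomputable def B (n : ℕ) : ℝ := (n : ℝ) ^ 2 * ((n : ℝ) - 4) ^ 2 / 16

/-- The exponent `p = (n+4)/(n-4)`. -/
noncomputable def p (n : ℕ) : ℝ := ((n : ℝ) + 4) / ((n : ℝ) - 4)

/-- The nonlinearity `f(v) = |v|^(p-1) v - B v`. -/
noncomputable def f (n : ℕ) (v : ℝ) : ℝ := |v| ^ (p n - 1) * v - B n * v

/-- The constant `a₀ = (n(n-4)/4)^((n-4)/4)`. -/
noncomputable def a₀ (n : ℕ) : ℝ := ((n : ℝ) * ((n : ℝ) - 4) / 4) ^ (((n : ℝ) - 4) / 4)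

/-- The constant `c_n = ((n-4)(n-2)n(n+2))^((n-4)/8)`. -/
noncomputable def c (n : ℕ) : ℝ :=
  (((n : ℝ) - 4) * ((n : ℝ) - 2) * (n : ℝ) * ((n : ℝ) + 2)) ^ (((n : ℝ) - 4) / 8)

/-- The potential `F(v) = |v|^(p+1)/(p+1) - (B/2) v²`. -/
noncomputable def F (n : ℕ) (s : ℝ) : ℝ := |s| ^ (p n + 1) / (p n + 1) - B n / 2 * s ^ 2

/-- The energy `E_v(t) = -v''' v' + v''²/2 + (A/2) v'² + F(v)`. -/
noncomputable def E (n : ℕ) (v : ℝ → ℝ) (t : ℝ) : ℝ :=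
  -(iteratedDeriv 3 v t) * deriv v t + 1 / 2 * (iteratedDeriv 2 v t) ^ 2
    + A n / 2 * (deriv v t) ^ 2 + F n (v t)

end Paper

/-- A function whose derivative tends to `+∞` at `+∞` tends to `+∞`. -/
lemma tendsto_atTop_of_hasDerivAt_atTop {u u' : ℝ → ℝ} (hu : ∀ t, HasDerivAt u (u' t) t)
    (h : Tendsto u' atTop atTop) : Tendsto u atTop atTop := by
  obtain ⟨T, hT⟩ := eventually_atTop.1 (h.eventually_ge_atTop 1)
  have hlin : ∀ t ≥ T, u T + (t - T) ≤ u t := by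
    intro t ht
    have := (convex_Ici T).mul_sub_le_image_sub_of_le_deriv (f := u) (C := 1)
      (fun x _ => (hu x).continuousAt.continuousWithinAt)
      (fun x _ => (hu x).differentiableAt.differentiableWithinAt)
      (fun x hx => by
        rw [(hu x).deriv]
        exact hT x (interior_subset hx)) T Set.self_mem_Ici t ht ht
    linarith
  refine tendsto_atTop_mono' atTop ((eventually_ge_atTop T).mono hlin) ?_
  exact tendsto_atTop_add_const_left _ _ (tendsto_atTop_add_const_right _ _ tendsto_id)

/-- The differential inequality `L' ≥ c exp (ε L)` has no global forward solution. -/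
lemma false_of_exp_le_deriv {L L' : ℝ → ℝ} {c ε T : ℝ} (hc : 0 < c) (hε : 0 < ε)
    (hL : ∀ t ≥ T, HasDerivAt L (L' t) t) (h : ∀ t ≥ T, c * exp (ε * L t) ≤ L' t) : False := by
  have hG : ∀ t ≥ T, HasDerivAt (fun t => exp (-(ε * L t)))
      (exp (-(ε * L t)) * -(ε * L' t)) t :=
    fun t ht => (((hL t ht).const_mul ε).neg).exp
  have hG' : ∀ t ≥ T, exp (-(ε * L t)) * -(ε * L' t) ≤ -(ε * c) := by
    intro t ht
    have h1 := mul_le_mul_of_nonneg_left (h t ht) (exp_pos (-(ε * L t))).le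
    have h2 : exp (-(ε * L t)) * (c * exp (ε * L t)) = c := by
      rw [mul_left_comm, ← exp_add]; simp
    rw [h2] at h1
    nlinarith [mul_le_mul_of_nonneg_left h1 hε.le]
  have hb : ∀ t ≥ T, exp (-(ε * L t)) - exp (-(ε * L T)) ≤ -(ε * c) * (t - T) := fun t ht =>
    (convex_Ici T).image_sub_le_mul_sub_of_deriv_le (f := fun t => exp (-(ε * L t)))
      (fun x hx => (hG x hx).continuousAt.continuousWithinAt)
      (fun x hx => (hG x (interior_subset hx)).differentiableAt.differentiableWithinAt)
      (fun x hx => by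
        rw [(hG x (interior_subset hx)).deriv]
        exact hG' x (interior_subset hx)) T Set.self_mem_Ici t ht ht
  have hεc : 0 < ε * c := mul_pos hε hc
  have hK := exp_pos (-(ε * L T))
  have h1 := hb (T + exp (-(ε * L T)) / (ε * c)) (by simp only [ge_iff_le]; linarith [div_pos hK hεc])
  have h2 : -(ε * c) * (T + exp (-(ε * L T)) / (ε * c) - T) = -exp (-(ε * L T)) := by
    field_simp
    ring
  rw [h2] at h1
  linarith [exp_pos (-(ε * L (T + exp (-(ε * L T)) / (ε * c))))]

/-- Positive quantities with `x₁, x₂, x₃, x₄` the successive derivatives of `x₀` and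
`x₄ ≥ x₀ ^ p / 2` satisfy a superlinear bound on the logarithmic derivative of
`x₀ x₁ x₂ x₃`. -/
lemma exp_sum_log_le_sum_div {p x₀ x₁ x₂ x₃ x₄ : ℝ} (hp : 1 < p) (h₀ : 0 < x₀) (h₁ : 0 < x₁)
    (h₂ : 0 < x₂) (h₃ : 0 < x₃) (h₄ : x₀ ^ p / 2 ≤ x₄) :
    1 / 2 * exp ((p - 1) / (10 + 6 * p) * (log x₀ + log x₁ + log x₂ + log x₃)) ≤
      x₁ / x₀ + x₂ / x₁ + x₃ / x₂ + x₄ / x₃ := by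
  set s := (p - 1) / (10 + 6 * p) * (log x₀ + log x₁ + log x₂ + log x₃) with hs
  have hs' : (10 + 6 * p) * s = (p - 1) * (log x₀ + log x₁ + log x₂ + log x₃) := by
    rw [hs]; field_simp
  have e₁ : exp (log x₁ - log x₀) = x₁ / x₀ := by rw [exp_sub, exp_log h₁, exp_log h₀]
  have e₂ : exp (log x₂ - log x₁) = x₂ / x₁ := by rw [exp_sub, exp_log h₂, exp_log h₁]
  have e₃ : exp (log x₃ - log x₂) = x₃ / x₂ := by rw [exp_sub, exp_log h₃, exp_log h₂]
  have e₄ : 1 / 2 * exp (p * log x₀ - log x₃) ≤ x₄ / x₃ := by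
    rw [exp_sub, exp_log h₃, mul_comm p, ← rpow_def_of_pos h₀, ← mul_div_assoc]
    gcongr
    linarith
  have p₁ := div_pos h₁ h₀
  have p₂ := div_pos h₂ h₁
  have p₃ := div_pos h₃ h₂
  have p₄ : 0 < x₄ / x₃ := lt_of_lt_of_le (by positivity) e₄
  have hE := exp_pos s
  by_cases c₁ : s ≤ log x₁ - log x₀
  · have := exp_le_exp.2 c₁; linarith
  by_cases c₂ : s ≤ log x₂ - log x₁
  · have := exp_le_exp.2 c₂; linarith
  by_cases c₃ : s ≤ log x₃ - log x₂
  · have := exp_le_exp.2 c₃; linarith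
  by_cases c₄ : s ≤ p * log x₀ - log x₃
  · have := exp_le_exp.2 c₄; linarith
  push Not at c₁ c₂ c₃ c₄
  nlinarith [mul_lt_mul_of_pos_left c₁ (show 0 < 1 + 3 * p by linarith),
    mul_lt_mul_of_pos_left c₂ (show 0 < 2 + 2 * p by linarith),
    mul_lt_mul_of_pos_left c₃ (show 0 < 3 + p by linarith)]

/-- Global solutions of `v'''' = A v'' + |v|^(p-1) v - B v`, written as a first-order system with
`A ≥ 0` and `p > 1`, do not tend to `+∞` at `+∞`. -/
lemma not_tendsto_atTop_of_fourth_order {A B p : ℝ} (hA : 0 ≤ A) (hp : 1 < p)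
    {v₀ v₁ v₂ v₃ v₄ : ℝ → ℝ} (h₀ : ∀ t, HasDerivAt v₀ (v₁ t) t)
    (h₁ : ∀ t, HasDerivAt v₁ (v₂ t) t) (h₂ : ∀ t, HasDerivAt v₂ (v₃ t) t)
    (h₃ : ∀ t, HasDerivAt v₃ (v₄ t) t)
    (hode : ∀ t, v₄ t = A * v₂ t + (|v₀ t| ^ (p - 1) * v₀ t - B * v₀ t)) :
    ¬ Tendsto v₀ atTop atTop := by
  intro h
  have hf : ∀ᶠ t in atTop, v₀ t ^ p / 2 ≤ |v₀ t| ^ (p - 1) * v₀ t - B * v₀ t := by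
    filter_upwards [h.eventually_gt_atTop 0,
      ((tendsto_rpow_atTop (sub_pos.2 hp)).comp h).eventually_ge_atTop (2 * B)] with t ht hB
    simp only [Function.comp_apply] at hB
    have hpow : v₀ t ^ p = v₀ t ^ (p - 1) * v₀ t := by
      rw [← rpow_add_one ht.ne', sub_add_cancel]
    rw [abs_of_pos ht, hpow]
    nlinarith [mul_le_mul_of_nonneg_right hB ht.le]
  have hftop : Tendsto (fun t => |v₀ t| ^ (p - 1) * v₀ t - B * v₀ t) atTop atTop :=
    tendsto_atTop_mono' atTop hf
      (((tendsto_rpow_atTop (zero_lt_one.trans hp)).comp h).atTop_div_const two_pos)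
  have hw' : Tendsto (fun t => v₃ t - A * v₁ t) atTop atTop := by
    refine tendsto_atTop_of_hasDerivAt_atTop (fun t => (h₃ t).sub ((h₁ t).const_mul A)) ?_
    refine hftop.congr fun t => ?_
    rw [hode t]; ring
  have hw : Tendsto (fun t => v₂ t - A * v₀ t) atTop atTop :=
    tendsto_atTop_of_hasDerivAt_atTop (fun t => (h₂ t).sub ((h₀ t).const_mul A)) hw'
  have t₂ : Tendsto v₂ atTop atTop := by
    refine tendsto_atTop_mono' atTop ?_ hw
    filter_upwards [h.eventually_ge_atTop 0] with t ht
    linarith [mul_nonneg hA ht]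
  have t₁ : Tendsto v₁ atTop atTop := tendsto_atTop_of_hasDerivAt_atTop h₁ t₂
  have h₄ : ∀ᶠ t in atTop, |v₀ t| ^ (p - 1) * v₀ t - B * v₀ t ≤ v₄ t := by
    filter_upwards [t₂.eventually_ge_atTop 0] with t ht
    linarith [mul_nonneg hA ht, hode t]
  have t₃ : Tendsto v₃ atTop atTop :=
    tendsto_atTop_of_hasDerivAt_atTop h₃ (tendsto_atTop_mono' atTop h₄ hftop)
  obtain ⟨T, hT⟩ := eventually_atTop.1 <| (h.eventually_gt_atTop 0).and <|
    (t₁.eventually_gt_atTop 0).and <| (t₂.eventually_gt_atTop 0).and <|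
    (t₃.eventually_gt_atTop 0).and <| hf.and h₄
  refine false_of_exp_le_deriv (L := fun t => log (v₀ t) + log (v₁ t) + log (v₂ t) + log (v₃ t))
    (L' := fun t => v₁ t / v₀ t + v₂ t / v₁ t + v₃ t / v₂ t + v₄ t / v₃ t)
    (c := 1 / 2) (ε := (p - 1) / (10 + 6 * p)) (T := T) (by norm_num)
    (div_pos (by linarith) (by linarith)) (fun t ht => ?_) (fun t ht => ?_)
  · obtain ⟨q₀, q₁, q₂, q₃, -, -⟩ := hT t ht
    exact ((((h₀ t).log q₀.ne').add ((h₁ t).log q₁.ne')).add ((h₂ t).log q₂.ne')).add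
      ((h₃ t).log q₃.ne')
  · obtain ⟨q₀, q₁, q₂, q₃, q₄, q₅⟩ := hT t ht
    exact exp_sum_log_le_sum_div hp q₀ q₁ q₂ q₃ (q₄.trans q₅)

lemma ContDiff.hasDerivAt_iteratedDeriv {v : ℝ → ℝ} {m : ℕ∞} (hv : ContDiff ℝ m v) {k : ℕ}
    (hk : (k : ℕ∞) < m) (t : ℝ) :
    HasDerivAt (iteratedDeriv k v) (iteratedDeriv (k + 1) v t) t := by
  rw [iteratedDeriv_succ]
  exact (hv.differentiable_iteratedDeriv k (by exact_mod_cast hk) t).hasDerivAt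

lemma not_tendsto_atTop_of_solution (n : ℕ) (hn : 5 ≤ n) (v : ℝ → ℝ) (hreg : ContDiff ℝ 4 v)
    (hode : ∀ t : ℝ, iteratedDeriv 4 v t - Paper.A n * iteratedDeriv 2 v t
      - Paper.f n (v t) = 0) : ¬ Tendsto v atTop atTop := by
  have hn' : (5 : ℝ) ≤ n := by exact_mod_cast hn
  have hA : 0 ≤ Paper.A n := by
    unfold Paper.A
    nlinarith
  have hp : 1 < Paper.p n := by
    unfold Paper.p
    rw [one_lt_div (by linarith)]
    linarith
  have hreg' : ContDiff ℝ ((4 : ℕ∞) : WithTop ℕ∞) v := hreg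
  have hd (k : ℕ) (hk : k < 4) (t : ℝ) :
      HasDerivAt (iteratedDeriv k v) (iteratedDeriv (k + 1) v t) t :=
    hreg'.hasDerivAt_iteratedDeriv (by exact_mod_cast hk) t
  rw [← iteratedDeriv_zero (f := v)]
  refine not_tendsto_atTop_of_fourth_order (B := Paper.B n) hA hp (hd 0 (by norm_num))
    (hd 1 (by norm_num)) (hd 2 (by norm_num)) (hd 3 (by norm_num)) fun t => ?_
  have := hode t
  rw [Paper.f] at this
  simp only [iteratedDeriv_zero, Nat.reduceAdd]
  linarith

/-- **Lemma 6 (Lemma 2.1 in [wei]).** A `C⁴` solution of `v'''' - A v'' - f(v) = 0` on all of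
`ℝ` does not tend to `+∞` or `-∞` as `t → ∞`, nor as `t → -∞`; in particular any limit of
`v(t)` at `±∞` in `ℝ ∪ {±∞}` is a finite real number. -/
theorem no_infinite_limits (n : ℕ) (hn : 5 ≤ n) (v : ℝ → ℝ)
    (hreg : ContDiff ℝ 4 v)
    (hode : ∀ t : ℝ, iteratedDeriv 4 v t - Paper.A n * iteratedDeriv 2 v t
      - Paper.f n (v t) = 0) :
    ¬ Tendsto v atTop atTop ∧ ¬ Tendsto v atTop atBot ∧
    ¬ Tendsto v atBot atTop ∧ ¬ Tendsto v atBot atBot := by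
  have hneg : ∀ u : ℝ → ℝ, (∀ t : ℝ, iteratedDeriv 4 u t - Paper.A n * iteratedDeriv 2 u t
      - Paper.f n (u t) = 0) → ∀ t : ℝ, iteratedDeriv 4 (-u) t
      - Paper.A n * iteratedDeriv 2 (-u) t - Paper.f n ((-u) t) = 0 := by
    intro u hu t
    have := hu t
    simp only [iteratedDeriv_neg, Pi.neg_apply, Paper.f, abs_neg] at this ⊢
    linarith
  have hreg' : ContDiff ℝ 4 (fun t => v (-t)) := hreg.comp contDiff_neg
  have hode' : ∀ t : ℝ, iteratedDeriv 4 (fun t => v (-t)) t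
      - Paper.A n * iteratedDeriv 2 (fun t => v (-t)) t - Paper.f n (v (-t)) = 0 := by
    intro t
    have := hode (-t)
    simp only [iteratedDeriv_comp_neg, smul_eq_mul]
    linarith
  refine ⟨not_tendsto_atTop_of_solution n hn v hreg hode, fun h => ?_, fun h => ?_, fun h => ?_⟩
  · exact not_tendsto_atTop_of_solution n hn (-v) hreg.neg (hneg v hode)
      (tendsto_neg_atBot_atTop.comp h)
  · exact not_tendsto_atTop_of_solution n hn _ hreg' hode' (h.comp tendsto_neg_atTop_atBot)
  · exact not_tendsto_atTop_of_solution n hn _ hreg'.neg (hneg _ hode')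
      (tendsto_neg_atBot_atTop.comp (h.comp tendsto_neg_atTop_atBot))
end

section
/- Let v ∈ C⁴(ℝ) be a bounded solution of the ODE v'''' − A·v'' − f(v) = 0 on ℝ, and suppose v'(t₀) = 0 for some t₀ ∈ ℝ. Then v is symmetric with respect to t₀: v(t₀ + t) = v(t₀ − t) for all t ∈ ℝ. -/
open Real Filter

theorem hasDerivAt_exp_neg_mul {y g : ℝ → ℝ} {k t : ℝ}
    (hy : HasDerivAt y (g t + k * y t) t) :
    HasDerivAt (fun t => exp (-k * t) * y t) (exp (-k * t) * g t) t := by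
  have h1 : HasDerivAt (fun t => exp (-k * t)) (exp (-k * t) * -k) t := by
    simpa using ((hasDerivAt_id t).const_mul (-k)).exp
  exact (h1.mul hy).congr_deriv (by ring)

/-- A solution of `y' = g + k y` with `g ≥ 0` grows at least like the homogeneous solution. -/
theorem exp_mul_le_of_hasDerivAt {y g : ℝ → ℝ} {k T : ℝ} (hT : 0 ≤ T)
    (hy : ∀ t, HasDerivAt y (g t + k * y t) t) (hg : ∀ t ∈ Set.Ioo 0 T, 0 ≤ g t) :
    exp (k * T) * y 0 ≤ y T := by
  have hd := fun t => hasDerivAt_exp_neg_mul (hy t)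
  have hm := monotoneOn_of_hasDerivWithinAt_nonneg (convex_Icc 0 T)
    (fun t _ => (hd t).continuousAt.continuousWithinAt) (fun t _ => (hd t).hasDerivWithinAt)
    (by
      intro t ht
      rw [interior_Icc] at ht
      exact mul_nonneg (exp_pos _).le (hg t ht))
  have h0 := hm (Set.left_mem_Icc.2 hT) (Set.right_mem_Icc.2 hT) hT
  have he : exp (k * T) * exp (-k * T) = 1 := by rw [← exp_add]; simp
  calc exp (k * T) * y 0 ≤ exp (k * T) * (exp (-k * T) * y T) := by
        have := exp_pos (k * T)
        gcongr
        simpa using h0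
    _ = y T := by rw [← mul_assoc, he, one_mul]

/-- A solution of `y' = g + k y` with `y 0 = 0` and `g > 0` is positive. -/
theorem pos_of_hasDerivAt {y g : ℝ → ℝ} {k T : ℝ} (hT : 0 < T) (h0 : y 0 = 0)
    (hy : ∀ t, HasDerivAt y (g t + k * y t) t) (hg : ∀ t ∈ Set.Ioo 0 T, 0 < g t) :
    0 < y T := by
  have hd := fun t => hasDerivAt_exp_neg_mul (hy t)
  have hm := strictMonoOn_of_hasDerivWithinAt_pos (convex_Icc 0 T)
    (fun t _ => (hd t).continuousAt.continuousWithinAt) (fun t _ => (hd t).hasDerivWithinAt)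
    (by
      intro t ht
      rw [interior_Icc] at ht
      exact mul_pos (exp_pos _) (hg t ht))
  have h1 := hm (Set.left_mem_Icc.2 hT.le) (Set.right_mem_Icc.2 hT.le) hT
  simp only [h0, mul_zero] at h1
  exact pos_of_mul_pos_right h1 (exp_pos _).le

theorem le_of_hasDerivAt_nonneg {y y' : ℝ → ℝ} {s T : ℝ} (hT : s ≤ T)
    (hy : ∀ t, HasDerivAt y (y' t) t) (hg : ∀ t, s ≤ t → 0 ≤ y' t) : y s ≤ y T :=
  monotoneOn_of_hasDerivWithinAt_nonneg (convex_Icc s T)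
    (fun t _ => (hy t).continuousAt.continuousWithinAt) (fun t _ => (hy t).hasDerivWithinAt)
    (fun t ht => hg t (interior_subset ht).1) (Set.left_mem_Icc.2 hT) (Set.right_mem_Icc.2 hT) hT

/-- In a cooperative chain of first-order equations, a positive initial value of the last
component makes the first component unbounded. -/
theorem unbounded_of_cooperative {y₁ y₂ y₃ y₄ h : ℝ → ℝ} {a b : ℝ} (ha : 0 < a)
    (h₁ : ∀ t, HasDerivAt y₁ (y₂ t + -a * y₁ t) t)
    (h₂ : ∀ t, HasDerivAt y₂ (y₃ t + a * y₂ t) t)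
    (h₃ : ∀ t, HasDerivAt y₃ (y₄ t + -b * y₃ t) t)
    (h₄ : ∀ t, HasDerivAt y₄ (h t + b * y₄ t) t)
    (hh : ∀ t, 0 ≤ y₁ t → 0 ≤ h t)
    (i₁ : y₁ 0 = 0) (i₂ : y₂ 0 = 0) (i₃ : y₃ 0 = 0) (i₄ : 0 < y₄ 0) (M : ℝ) :
    ∃ t, M < y₁ t := by
  have chain : ∀ T, 0 < T → (∀ t ∈ Set.Ioo 0 T, 0 < y₄ t) →
      ∀ t ∈ Set.Ioc 0 T, 0 < y₁ t ∧ 0 < y₂ t ∧ 0 < y₃ t := by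
    intro T hT h4
    have p3 : ∀ t ∈ Set.Ioc 0 T, 0 < y₃ t := fun t ht =>
      pos_of_hasDerivAt ht.1 i₃ h₃ fun s hs => h4 s ⟨hs.1, hs.2.trans_le ht.2⟩
    have p2 : ∀ t ∈ Set.Ioc 0 T, 0 < y₂ t := fun t ht =>
      pos_of_hasDerivAt ht.1 i₂ h₂ fun s hs => p3 s ⟨hs.1, hs.2.le.trans ht.2⟩
    have p1 : ∀ t ∈ Set.Ioc 0 T, 0 < y₁ t := fun t ht =>
      pos_of_hasDerivAt ht.1 i₁ h₁ fun s hs => p2 s ⟨hs.1, hs.2.le.trans ht.2⟩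
    exact fun t ht => ⟨p1 t ht, p2 t ht, p3 t ht⟩
  have p4 : ∀ t, 0 < t → 0 < y₄ t := by
    by_contra! hcon
    obtain ⟨t, ht, hyt⟩ := hcon
    have hc4 : Continuous y₄ := continuous_iff_continuousAt.2 fun t => (h₄ t).continuousAt
    let S : Set ℝ := Set.Ici 0 ∩ {s | y₄ s ≤ 0}
    have hS : IsClosed S := isClosed_Ici.inter (isClosed_le hc4 continuous_const)
    have hB : BddBelow S := ⟨0, fun s hs => hs.1⟩
    have hmem : sInf S ∈ S := hS.csInf_mem ⟨t, ht.le, hyt⟩ hB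
    have hle : y₄ (sInf S) ≤ 0 := hmem.2
    have hpos : 0 < sInf S := lt_of_le_of_ne hmem.1 fun h0 => by
      rw [← h0] at hle
      exact hle.not_gt i₄
    have hbefore : ∀ s ∈ Set.Ioo 0 (sInf S), 0 < y₄ s := by
      intro s hs
      by_contra hneg
      exact (csInf_le hB ⟨hs.1.le, not_lt.1 hneg⟩).not_gt hs.2
    have hch := chain _ hpos hbefore
    have := exp_mul_le_of_hasDerivAt hpos.le h₄
      fun s hs => hh s (hch s ⟨hs.1, hs.2.le⟩).1.le
    have := mul_pos (exp_pos (b * sInf S)) i₄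
    linarith
  have pos : ∀ t, 0 < t → 0 < y₁ t ∧ 0 < y₂ t ∧ 0 < y₃ t := fun t ht =>
    chain t ht (fun s hs => p4 s hs.1) t ⟨ht, le_rfl⟩
  by_contra! hM
  set k := y₂ 1 with hk
  have kpos : 0 < k := (pos 1 one_pos).2.1
  have hk2 : ∀ t, 1 ≤ t → k ≤ y₂ t := fun t ht =>
    le_of_hasDerivAt_nonneg ht h₂ fun s hs => by
      have hs' := pos s (by linarith)
      have := mul_pos ha hs'.2.1
      linarith [hs'.2.2]
  have hlin : ∀ t, 1 ≤ t → a * k * (t - 1) ≤ y₂ t := by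
    intro t ht
    have := le_of_hasDerivAt_nonneg (y := fun t => y₂ t - a * k * t) ht
      (fun s => (h₂ s).sub ((hasDerivAt_id s).const_mul (a * k))) fun s hs => by
        have hs' := pos s (by linarith)
        have := mul_le_mul_of_nonneg_left (hk2 s hs) ha.le
        linarith [hs'.2.2]
    linarith
  have hM0 : 0 ≤ M := i₁ ▸ hM 0
  set T := 1 + (a * M + 1) / (a * k) with hTdef
  have hak : 0 < a * k := mul_pos ha kpos
  have hT1 : 1 ≤ T := by
    have : 0 ≤ (a * M + 1) / (a * k) := by positivity
    linarith
  have hgrow := le_of_hasDerivAt_nonneg (y := fun t => y₁ t - t) (s := T) (T := T + M + 1)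
    (by linarith) (fun s => (h₁ s).sub (hasDerivAt_id s)) fun s hs => by
      have e1 := hlin s (hT1.trans hs)
      have e2 : a * k * (T - 1) = a * M + 1 := by
        rw [hTdef]; field_simp; ring
      have e3 := mul_le_mul_of_nonneg_left hs hak.le
      have e4 := mul_le_mul_of_nonneg_left (hM s) ha.le
      linarith
  have := (pos T (by linarith)).1
  have := hM (T + M + 1)
  linarith

/-- A linearly controlled chain of first-order equations has unique solutions. -/
theorem eq_zero_of_chain {y₁ y₂ y₃ y₄ h : ℝ → ℝ} {a b L : ℝ}
    (h₁ : ∀ t, HasDerivAt y₁ (y₂ t + -a * y₁ t) t)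
    (h₂ : ∀ t, HasDerivAt y₂ (y₃ t + a * y₂ t) t)
    (h₃ : ∀ t, HasDerivAt y₃ (y₄ t + -b * y₃ t) t)
    (h₄ : ∀ t, HasDerivAt y₄ (h t + b * y₄ t) t)
    (hh : ∀ t, |h t| ≤ L * |y₁ t|) (hL : 0 ≤ L)
    (i₁ : y₁ 0 = 0) (i₂ : y₂ 0 = 0) (i₃ : y₃ 0 = 0) (i₄ : y₄ 0 = 0) {t : ℝ} (ht : 0 ≤ t) :
    y₁ t = 0 := by
  have hd : ∀ s, HasDerivAt (fun s => (y₁ s, y₂ s, y₃ s, y₄ s))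
      (y₂ s + -a * y₁ s, y₃ s + a * y₂ s, y₄ s + -b * y₃ s, h s + b * y₄ s) s :=
    fun s => (h₁ s).prodMk ((h₂ s).prodMk ((h₃ s).prodMk (h₄ s)))
  have key := eq_zero_of_abs_deriv_le_mul_abs_self_of_eq_zero_right (a := 0) (b := t)
    (K := 1 + L + |a| + |b|)
    (fun s _ => (hd s).continuousAt.continuousWithinAt) (fun s _ => (hd s).hasDerivWithinAt)
    (by simp [i₁, i₂, i₃, i₄]) (by
      intro s _
      set N := ‖(y₁ s, y₂ s, y₃ s, y₄ s)‖ with hN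
      have n1 : |y₁ s| ≤ N := norm_fst_le (y₁ s, y₂ s, y₃ s, y₄ s)
      have nn := norm_snd_le (y₁ s, y₂ s, y₃ s, y₄ s)
      have n2 : |y₂ s| ≤ N := (norm_fst_le (y₂ s, y₃ s, y₄ s)).trans nn
      have nn2 := (norm_snd_le (y₂ s, y₃ s, y₄ s)).trans nn
      have n3 : |y₃ s| ≤ N := (norm_fst_le (y₃ s, y₄ s)).trans nn2
      have n4 : |y₄ s| ≤ N := (norm_snd_le (y₃ s, y₄ s)).trans nn2
      have bound : ∀ u w k C : ℝ, |u| ≤ C * N → |w| ≤ N → 0 ≤ C → C + |k| ≤ 1 + L + |a| + |b| →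
          ‖u + k * w‖ ≤ (1 + L + |a| + |b|) * N := by
        intro u w k C hu hw _ hC
        calc |u + k * w| ≤ |u| + |k| * |w| := by
              rw [← abs_mul]; exact abs_add_le _ _
          _ ≤ C * N + |k| * N := by gcongr
          _ = (C + |k|) * N := by ring
          _ ≤ _ := mul_le_mul_of_nonneg_right hC (norm_nonneg _)
      have := abs_nonneg a
      have := abs_nonneg b
      refine norm_prod_le_iff.2 ⟨bound _ _ _ 1 (by simpa using n2) n1 zero_le_one ?_,
        norm_prod_le_iff.2 ⟨bound _ _ _ 1 (by simpa using n3) n2 zero_le_one ?_,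
        norm_prod_le_iff.2 ⟨bound _ _ _ 1 (by simpa using n4) n3 zero_le_one ?_,
        bound _ _ _ L ((hh s).trans (by gcongr)) n4 hL ?_⟩⟩⟩ <;>
      (try rw [abs_neg]) <;> linarith)
    t (Set.right_mem_Icc.2 ht)
  exact congrArg Prod.fst key

theorem abs_rpow_sub_one_mul_self_eq {p : ℝ} (hp : 1 ≤ p) (x : ℝ) :
    |x| ^ (p - 1) * x = max x 0 ^ p - max (-x) 0 ^ p := by
  have hp0 : p ≠ 0 := by linarith
  rcases lt_trichotomy x 0 with hx | rfl | hx
  · rw [abs_of_neg hx, max_eq_right hx.le, max_eq_left (by linarith), zero_rpow hp0,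
      rpow_sub_one (by linarith)]
    have hx0 : x ≠ 0 := hx.ne
    field_simp
    ring
  · simp
  · rw [abs_of_pos hx, max_eq_left hx.le, max_eq_right (by linarith), zero_rpow hp0,
      rpow_sub_one hx.ne']
    field_simp
    ring

theorem monotone_abs_rpow_sub_one_mul_self {p : ℝ} (hp : 1 ≤ p) :
    Monotone fun x : ℝ => |x| ^ (p - 1) * x := by
  intro x y hxy
  simp only [abs_rpow_sub_one_mul_self_eq hp]
  have hp0 : 0 ≤ p := by linarith
  have h1 : max x 0 ^ p ≤ max y 0 ^ p :=
    rpow_le_rpow (le_max_right _ _) (max_le_max_right 0 hxy) hp0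
  have h2 : max (-y) 0 ^ p ≤ max (-x) 0 ^ p :=
    rpow_le_rpow (le_max_right _ _) (max_le_max_right 0 (neg_le_neg hxy)) hp0
  linarith

theorem abs_rpow_sub_rpow_le {p M x y : ℝ} (hp : 1 ≤ p) (hx : x ∈ Set.Icc 0 M)
    (hy : y ∈ Set.Icc 0 M) : |x ^ p - y ^ p| ≤ p * M ^ (p - 1) * |x - y| := by
  refine (convex_Icc 0 M).norm_image_sub_le_of_norm_hasDerivWithin_le
    (f := fun x : ℝ => x ^ p) (f' := fun x => p * x ^ (p - 1))
    (fun z _ => (hasDerivAt_rpow_const (Or.inr hp)).hasDerivWithinAt) (fun z hz => ?_) hy hx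
  have h0 := rpow_nonneg hz.1 (p - 1)
  rw [norm_of_nonneg (by positivity)]
  exact mul_le_mul_of_nonneg_left (rpow_le_rpow hz.1 hz.2 (by linarith)) (by linarith)

theorem abs_rpow_sub_one_mul_self_sub_le {p M x y : ℝ} (hp : 1 ≤ p) (hx : |x| ≤ M)
    (hy : |y| ≤ M) :
    |(|x| ^ (p - 1) * x - |y| ^ (p - 1) * y)| ≤ 2 * (p * M ^ (p - 1)) * |x - y| := by
  have hM : 0 ≤ M := (abs_nonneg x).trans hx
  rw [abs_rpow_sub_one_mul_self_eq hp, abs_rpow_sub_one_mul_self_eq hp]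
  rw [abs_le] at hx hy
  have e1 := abs_rpow_sub_rpow_le (M := M) (x := max x 0) (y := max y 0) hp
    ⟨le_max_right _ _, max_le hx.2 hM⟩ ⟨le_max_right _ _, max_le hy.2 hM⟩
  have e2 := abs_rpow_sub_rpow_le (M := M) (x := max (-x) 0) (y := max (-y) 0) hp
    ⟨le_max_right _ _, max_le (by linarith) hM⟩ ⟨le_max_right _ _, max_le (by linarith) hM⟩
  have e3 : |max x 0 - max y 0| ≤ |x - y| := abs_max_sub_max_le_abs x y 0
  have e4 : |max (-x) 0 - max (-y) 0| ≤ |x - y| :=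
    (abs_max_sub_max_le_abs (-x) (-y) 0).trans_eq (by rw [← abs_neg]; congr 1; ring)
  have hC : 0 ≤ p * M ^ (p - 1) := mul_nonneg (by linarith) (rpow_nonneg hM _)
  have e5 := e1.trans (mul_le_mul_of_nonneg_left e3 hC)
  have e6 := e2.trans (mul_le_mul_of_nonneg_left e4 hC)
  rw [abs_le] at e5 e6 ⊢
  constructor <;> linarith [e5.1, e5.2, e6.1, e6.2]

/-- **Lemma 7 (i).** A bounded `C⁴` solution of `v'''' - A v'' - f(v) = 0` with `v'(t₀) = 0`
is symmetric with respect to `t₀`. -/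
theorem symmetry_at_critical_point (n : ℕ) (hn : 5 ≤ n) (v : ℝ → ℝ)
    (hreg : ContDiff ℝ 4 v)
    (hode : ∀ t : ℝ, iteratedDeriv 4 v t - Paper.A n * iteratedDeriv 2 v t
      - Paper.f n (v t) = 0)
    (hbd : ∃ M : ℝ, ∀ t : ℝ, |v t| ≤ M)
    (t₀ : ℝ) (ht₀ : deriv v t₀ = 0) :
    ∀ t : ℝ, v (t₀ + t) = v (t₀ - t) := by
  obtain ⟨M, hM⟩ := hbd
  have hn' : (5 : ℝ) ≤ n := by exact_mod_cast hn
  have hp : 1 ≤ Paper.p n := by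
    rw [Paper.p, le_div_iff₀ (by linarith)]
    linarith
  have hV : ∀ k : ℕ, k < 4 → ∀ t,
      HasDerivAt (iteratedDeriv k v) (iteratedDeriv (k + 1) v t) t := by
    intro k hk t
    rw [iteratedDeriv_succ]
    exact (hreg.differentiable_iteratedDeriv k (by exact_mod_cast hk) t).hasDerivAt
  -- The derivatives of the odd part of `v` about `t₀`, with `σ = ± 1` the orientation.
  let D : ℝ → ℕ → ℝ → ℝ := fun σ k t =>
    iteratedDeriv k v (t₀ + σ * t) * σ ^ k - iteratedDeriv k v (t₀ - σ * t) * (-σ) ^ k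
  have hD : ∀ σ, ∀ k : ℕ, k < 4 → ∀ t, HasDerivAt (D σ k) (D σ (k + 1) t) t := by
    intro σ k hk t
    have l1 : HasDerivAt (fun t => t₀ + σ * t) σ t := by
      simpa using ((hasDerivAt_id t).const_mul σ).const_add t₀
    have l2 : HasDerivAt (fun t => t₀ - σ * t) (-σ) t := by
      simpa using ((hasDerivAt_id t).const_mul σ).const_sub t₀
    have d1 := ((hV k hk (t₀ + σ * t)).comp t l1).mul_const (σ ^ k)
    have d2 := ((hV k hk (t₀ - σ * t)).comp t l2).mul_const ((-σ) ^ k)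
    refine (d1.sub d2).congr_deriv ?_
    simp only [D, pow_succ]
    ring
  set a : ℝ := ((n : ℝ) - 4) / 2 with ha
  set b : ℝ := (n : ℝ) / 2 with hb
  have hapos : 0 < a := by rw [ha]; linarith
  let g : ℝ → ℝ := fun x => |x| ^ (Paper.p n - 1) * x
  let H : ℝ → ℝ → ℝ := fun σ t => g (v (t₀ + σ * t)) - g (v (t₀ - σ * t))
  have hD4 : ∀ σ, σ ^ 2 = 1 → ∀ t,
      D σ 4 t = H σ t + (a ^ 2 + b ^ 2) * D σ 2 t - a ^ 2 * b ^ 2 * D σ 0 t := by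
    intro σ hσ t
    have e1 := hode (t₀ + σ * t)
    have e2 := hode (t₀ - σ * t)
    have h4 : σ ^ 4 = 1 := by rw [show σ ^ 4 = (σ ^ 2) ^ 2 by ring, hσ]; norm_num
    have h4' : (-σ) ^ 4 = 1 := by rw [← h4]; ring
    have h2' : (-σ) ^ 2 = 1 := by rw [← hσ]; ring
    have hA : Paper.A n = a ^ 2 + b ^ 2 := by rw [Paper.A, ha, hb]; ring
    have hB : Paper.B n = a ^ 2 * b ^ 2 := by rw [Paper.B, ha, hb]; ring
    simp only [Paper.f, hA, hB] at e1 e2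
    simp only [D, H, g, h4, h4', hσ, h2', pow_zero, mul_one, iteratedDeriv_zero]
    linarith
  have hD0 : ∀ σ t, D σ 0 t = v (t₀ + σ * t) - v (t₀ - σ * t) := by
    intro σ t
    simp [D]
  have z0 : ∀ σ, D σ 0 0 = 0 := fun σ => by simp [D]
  have z1 : ∀ σ, D σ 1 0 = 0 := fun σ => by simp [D, ht₀]
  have z2 : ∀ σ, D σ 2 0 = 0 := fun σ => by simp [D]
  have z3 : ∀ σ, D σ 3 0 = 2 * σ ^ 3 * iteratedDeriv 3 v t₀ := fun σ => by
    simp only [D, mul_zero, add_zero, sub_zero]; ring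
  have h₁ : ∀ σ t, HasDerivAt (D σ 0) ((D σ 1 t + a * D σ 0 t) + -a * D σ 0 t) t :=
    fun σ t => (hD σ 0 (by norm_num) t).congr_deriv (by ring)
  have h₂ : ∀ σ t, HasDerivAt (fun t => D σ 1 t + a * D σ 0 t)
      ((D σ 2 t - a ^ 2 * D σ 0 t) + a * (D σ 1 t + a * D σ 0 t)) t :=
    fun σ t => ((hD σ 1 (by norm_num) t).add
      ((hD σ 0 (by norm_num) t).const_mul a)).congr_deriv (by ring)
  have h₃ : ∀ σ t, HasDerivAt (fun t => D σ 2 t - a ^ 2 * D σ 0 t)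
      ((D σ 3 t - a ^ 2 * D σ 1 t + b * (D σ 2 t - a ^ 2 * D σ 0 t))
        + -b * (D σ 2 t - a ^ 2 * D σ 0 t)) t :=
    fun σ t => ((hD σ 2 (by norm_num) t).sub
      ((hD σ 0 (by norm_num) t).const_mul (a ^ 2))).congr_deriv (by ring)
  have h₄ : ∀ σ, σ ^ 2 = 1 → ∀ t,
      HasDerivAt (fun t => D σ 3 t - a ^ 2 * D σ 1 t + b * (D σ 2 t - a ^ 2 * D σ 0 t))
      (H σ t + b * (D σ 3 t - a ^ 2 * D σ 1 t + b * (D σ 2 t - a ^ 2 * D σ 0 t))) t :=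
    fun σ hσ t => (((hD σ 3 (by norm_num) t).sub
      ((hD σ 1 (by norm_num) t).const_mul (a ^ 2))).add
      (((hD σ 2 (by norm_num) t).sub
      ((hD σ 0 (by norm_num) t).const_mul (a ^ 2))).const_mul b)).congr_deriv (by
        simp only [Nat.reduceAdd]
        rw [hD4 σ hσ t]; ring)
  have hnonpos : ∀ σ, σ ^ 2 = 1 → D σ 3 0 ≤ 0 := by
    intro σ hσ
    by_contra! hpos
    obtain ⟨t, ht⟩ := unbounded_of_cooperative hapos (h₁ σ) (h₂ σ) (h₃ σ) (h₄ σ hσ)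
      (fun t ht => by
        rw [hD0] at ht
        exact sub_nonneg.2 (monotone_abs_rpow_sub_one_mul_self hp (sub_nonneg.1 ht)))
      (z0 σ) (by simp [z0, z1]) (by simp [z0, z2]) (by simpa [z0, z1, z2] using hpos) (2 * M)
    rw [hD0] at ht
    have u1 := abs_le.1 (hM (t₀ + σ * t))
    have u2 := abs_le.1 (hM (t₀ - σ * t))
    linarith [u1.2, u2.1]
  have hzero : iteratedDeriv 3 v t₀ = 0 := by
    have u1 := hnonpos 1 (by norm_num)
    have u2 := hnonpos (-1) (by norm_num)
    rw [z3] at u1 u2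
    linarith
  have hM0 : 0 ≤ M := (abs_nonneg _).trans (hM 0)
  have hsymm : ∀ t, 0 ≤ t → v (t₀ + t) = v (t₀ - t) := by
    intro t ht
    have := eq_zero_of_chain (h₁ 1) (h₂ 1) (h₃ 1) (h₄ 1 (by norm_num))
      (L := 2 * (Paper.p n * M ^ (Paper.p n - 1)))
      (fun t => by
        rw [hD0]
        exact abs_rpow_sub_one_mul_self_sub_le hp (hM _) (hM _))
      (mul_nonneg two_pos.le (mul_nonneg (by linarith) (rpow_nonneg hM0 _)))
      (z0 1) (by simp [z0, z1]) (by simp [z0, z2]) (by simp [z0, z1, z2, z3, hzero]) ht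
    rw [hD0] at this
    simpa using sub_eq_zero.1 this
  intro t
  rcases le_total 0 t with ht | ht
  · exact hsymm t ht
  · have := hsymm (-t) (by linarith)
    rw [← sub_eq_add_neg, sub_neg_eq_add] at this
    exact this.symm
end

section
/- Let v ∈ C⁴(ℝ) be a bounded solution of the ODE v'''' − A·v'' − f(v) = 0 on ℝ, and suppose v(t₀) = 0 for some t₀ ∈ ℝ. Then v is antisymmetric with respect to t₀: v(t₀ − t) = −v(t₀ + t) for all t ∈ ℝ. -/
open Real Filter

open Set Topology

/-- The maximum principle for the initial value problem `y'' ≥ k² y`. -/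
theorem nonneg_of_sq_mul_le_deriv_two {y y₁ y₂ : ℝ → ℝ} {k s : ℝ}
    (hy : ∀ t, HasDerivAt y (y₁ t) t) (hy₁ : ∀ t, HasDerivAt y₁ (y₂ t) t)
    (hle : ∀ t, 0 ≤ t → t < s → k ^ 2 * y t ≤ y₂ t) (h0 : 0 ≤ y 0)
    (h1 : 0 ≤ y₁ 0 + k * y 0) {t : ℝ} (ht : 0 ≤ t) (hts : t ≤ s) : 0 ≤ y t := by
  have hexp : ∀ c x : ℝ, HasDerivAt (fun x => exp (c * x)) (exp (c * x) * c) x := fun c x => by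
    simpa using ((hasDerivAt_id x).const_mul c).exp
  have hd : ∀ x, HasDerivAt (fun x => exp (-k * x) * (y₁ x + k * y x))
      (exp (-k * x) * (y₂ x - k ^ 2 * y x)) x := fun x => by
    refine ((hexp (-k) x).fun_mul ((hy₁ x).fun_add ((hy x).const_mul k))).congr_deriv ?_
    ring
  have hmono : MonotoneOn (fun x => exp (-k * x) * (y₁ x + k * y x)) (Icc 0 s) := by
    refine monotoneOn_of_deriv_nonneg (convex_Icc 0 s)
      (fun x _ => (hd x).continuousAt.continuousWithinAt)
      (fun x _ => (hd x).differentiableAt.differentiableWithinAt) fun x hx => ?_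
    rw [interior_Icc] at hx
    rw [(hd x).deriv]
    exact mul_nonneg (exp_pos _).le (sub_nonneg.2 (hle x hx.1.le hx.2))
  have hpos : ∀ x ∈ Icc 0 s, 0 ≤ y₁ x + k * y x := fun x hx => by
    have h := hmono ⟨le_rfl, hx.1.trans hx.2⟩ hx hx.1
    simp only [mul_zero, exp_zero, one_mul] at h
    exact nonneg_of_mul_nonneg_right (h1.trans h) (exp_pos _)
  have hd' : ∀ x, HasDerivAt (fun x => exp (k * x) * y x)
      (exp (k * x) * (y₁ x + k * y x)) x := fun x => by
    refine ((hexp k x).fun_mul (hy x)).congr_deriv ?_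
    ring
  have hmono' : MonotoneOn (fun x => exp (k * x) * y x) (Icc 0 s) := by
    refine monotoneOn_of_deriv_nonneg (convex_Icc 0 s)
      (fun x _ => (hd' x).continuousAt.continuousWithinAt)
      (fun x _ => (hd' x).differentiableAt.differentiableWithinAt) fun x hx => ?_
    rw [interior_Icc] at hx
    rw [(hd' x).deriv]
    exact mul_nonneg (exp_pos _).le (hpos x ⟨hx.1.le, hx.2.le⟩)
  have h := hmono' ⟨le_rfl, ht.trans hts⟩ ⟨ht, hts⟩ ht
  simp only [mul_zero, exp_zero, one_mul] at h
  exact nonneg_of_mul_nonneg_right (h0.trans h) (exp_pos _)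

/-- A solution of `(D² - a²)(D² - b²) u = h` with `h ≥ 0` wherever `u ≥ 0`, which is bounded and
satisfies `u(0) = u'(0) = u'''(0) = 0`, has `u''(0) ≤ 0`. -/
theorem deriv_two_nonpos_of_bounded {u u₁ u₂ u₃ u₄ : ℝ → ℝ} {a b M : ℝ}
    (hu : ∀ t, HasDerivAt u (u₁ t) t) (hu₁ : ∀ t, HasDerivAt u₁ (u₂ t) t)
    (hu₂ : ∀ t, HasDerivAt u₂ (u₃ t) t) (hu₃ : ∀ t, HasDerivAt u₃ (u₄ t) t)
    (hode : ∀ t, 0 ≤ u t → 0 ≤ u₄ t - (a ^ 2 + b ^ 2) * u₂ t + a ^ 2 * b ^ 2 * u t)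
    (hbd : ∀ t, u t ≤ M) (h0 : u 0 = 0) (h1 : u₁ 0 = 0) (h3 : u₃ 0 = 0) : u₂ 0 ≤ 0 := by
  by_contra! hc
  set c := u₂ 0
  have hz : ∀ t, HasDerivAt (fun t => u₂ t - a ^ 2 * u t) (u₃ t - a ^ 2 * u₁ t) t :=
    fun t => (hu₂ t).fun_sub ((hu t).const_mul _)
  have hz₁ : ∀ t, HasDerivAt (fun t => u₃ t - a ^ 2 * u₁ t) (u₄ t - a ^ 2 * u₂ t) t :=
    fun t => (hu₃ t).fun_sub ((hu₁ t).const_mul _)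
  have hnonneg : ∀ s, (∀ t, 0 ≤ t → t < s → 0 ≤ u₂ t - a ^ 2 * u t) →
      ∀ t, 0 ≤ t → t ≤ s → 0 ≤ u t := fun s hs t ht hts =>
    nonneg_of_sq_mul_le_deriv_two (k := a) hu hu₁
      (fun x hx hxs => by linarith [hs x hx hxs]) h0.ge (by simp [h0, h1]) ht hts
  have hstep : ∀ s, 0 ≤ s → (∀ t, 0 ≤ t → t < s → 0 ≤ u₂ t - a ^ 2 * u t) →
      c ≤ u₂ s - a ^ 2 * u s := fun s hs0 hs => by
    refine sub_nonneg.1 (nonneg_of_sq_mul_le_deriv_two (k := 0) (s := s)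
      (y := fun t => u₂ t - a ^ 2 * u t - c) (fun t => (hz t).sub_const c) hz₁
      (fun x hx hxs => ?_) (by simp [h0, c]) (by simp [h1, h3]) hs0 le_rfl)
    have h₁ := hode x (hnonneg s hs x hx hxs.le)
    have h₂ := mul_nonneg (sq_nonneg b) (hs x hx hxs)
    linarith
  have hzpos : ∀ T, 0 ≤ T → 0 < u₂ T - a ^ 2 * u T := by
    intro T hT
    by_contra! hneg
    have hcont : Continuous fun t => u₂ t - a ^ 2 * u t :=
      continuous_iff_continuousAt.2 fun t => (hz t).continuousAt
    have hcomp : IsCompact (Icc 0 T ∩ {t | u₂ t - a ^ 2 * u t ≤ 0}) :=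
      isCompact_Icc.inter_right (isClosed_le hcont continuous_const)
    obtain ⟨s, ⟨hsT, hs⟩, hleast⟩ := hcomp.exists_isLeast ⟨T, ⟨hT, le_rfl⟩, hneg⟩
    have := hstep s hsT.1 fun t ht hts => by
      by_contra! hlt
      exact absurd (hleast ⟨⟨ht, hts.le.trans hsT.2⟩, hlt.le⟩) (not_le.2 hts)
    exact absurd hs (not_le.2 (hc.trans_le this))
  have hall : ∀ t, 0 ≤ t → 0 ≤ u t := fun t ht =>
    hnonneg t (fun x hx _ => (hzpos x hx).le) t ht le_rfl
  have hgrow : ∀ t, 0 ≤ t → c / 2 * t ^ 2 ≤ u t := by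
    intro t ht
    refine sub_nonneg.1 (nonneg_of_sq_mul_le_deriv_two (k := 0) (s := t)
      (y := fun t => u t - c / 2 * t ^ 2) (y₁ := fun t => u₁ t - c * t) (y₂ := fun t => u₂ t - c)
      (fun x => ?_) (fun x => ?_) (fun x hx _ => ?_) (by simp [h0]) (by simp [h1]) ht le_rfl)
    · refine ((hu x).fun_sub ((hasDerivAt_pow 2 x).const_mul (c / 2))).congr_deriv ?_
      push_cast
      ring
    · simpa using (hu₁ x).fun_sub ((hasDerivAt_id x).const_mul c)
    · have h₁ := hstep x hx fun y hy _ => (hzpos y hy).le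
      have h₂ := mul_nonneg (sq_nonneg a) (hall x hx)
      linarith
  have hM : 0 ≤ M := h0 ▸ hbd 0
  have hT : 0 ≤ 2 * (M + 1) / c + 1 := by positivity
  have h₁ := (hgrow _ hT).trans (hbd _)
  have h₂ : c / 2 * (2 * (M + 1) / c + 1) ^ 2
      = (M + 1) + (M + 1) + c / 2 + c / 2 * (2 * (M + 1) / c) ^ 2 := by
    field_simp
    ring
  have h₃ : 0 ≤ c / 2 * (2 * (M + 1) / c) ^ 2 := by positivity
  linarith

/-- Uniqueness for the zero initial value problem of a linearly bounded fourth order equation. -/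
theorem eq_zero_of_abs_deriv_four_le {u u₁ u₂ u₃ u₄ : ℝ → ℝ} {K N : ℝ} (hK : 0 ≤ K) (hN : 0 ≤ N)
    (hu : ∀ t, HasDerivAt u (u₁ t) t) (hu₁ : ∀ t, HasDerivAt u₁ (u₂ t) t)
    (hu₂ : ∀ t, HasDerivAt u₂ (u₃ t) t) (hu₃ : ∀ t, HasDerivAt u₃ (u₄ t) t)
    (hle : ∀ t, |u₄ t| ≤ K * |u₂ t| + N * |u t|)
    (h0 : u 0 = 0) (h1 : u₁ 0 = 0) (h2 : u₂ 0 = 0) (h3 : u₃ 0 = 0) {t : ℝ} (ht : 0 ≤ t) :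
    u t = 0 := by
  set Q : ℝ → ℝ := fun t => u t ^ 2 + u₁ t ^ 2 + u₂ t ^ 2 + u₃ t ^ 2 with hQ
  set C := 2 + K + N with hC
  have hQd : ∀ x, HasDerivAt Q
      (2 * (u x * u₁ x + u₁ x * u₂ x + u₂ x * u₃ x + u₃ x * u₄ x)) x := fun x => by
    refine (((((hu x).fun_pow 2).fun_add ((hu₁ x).fun_pow 2)).fun_add ((hu₂ x).fun_pow 2)).fun_add
      ((hu₃ x).fun_pow 2)).congr_deriv ?_
    push_cast
    ring
  have hQle : ∀ x, 2 * (u x * u₁ x + u₁ x * u₂ x + u₂ x * u₃ x + u₃ x * u₄ x) ≤ C * Q x := by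
    intro x
    have e₁ : u₃ x * u₄ x ≤ |u₃ x| * (K * |u₂ x| + N * |u x|) :=
      (le_abs_self _).trans ((abs_mul _ _).le.trans
        (mul_le_mul_of_nonneg_left (hle x) (abs_nonneg _)))
    have e₂ := mul_nonneg hK (sq_nonneg (|u₃ x| - |u₂ x|))
    have e₃ := mul_nonneg hN (sq_nonneg (|u₃ x| - |u x|))
    have e₄ := mul_nonneg hK (add_nonneg (sq_nonneg (u x)) (sq_nonneg (u₁ x)))
    have e₅ := mul_nonneg hN (add_nonneg (sq_nonneg (u₁ x)) (sq_nonneg (u₂ x)))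
    simp only [sub_sq, sq_abs] at e₂ e₃
    simp only [hC, hQ]
    linarith [sq_nonneg (u x - u₁ x), sq_nonneg (u₁ x - u₂ x), sq_nonneg (u₂ x - u₃ x),
      sq_nonneg (u x), sq_nonneg (u₃ x)]
  have hd : ∀ x, HasDerivAt (fun x => exp (-C * x) * Q x) (exp (-C * x) *
      (2 * (u x * u₁ x + u₁ x * u₂ x + u₂ x * u₃ x + u₃ x * u₄ x) - C * Q x)) x := fun x => by
    have he : HasDerivAt (fun x => exp (-C * x)) (exp (-C * x) * -C) x := by
      simpa using ((hasDerivAt_id x).const_mul (-C)).exp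
    refine (he.fun_mul (hQd x)).congr_deriv ?_
    ring
  have hanti : Antitone fun x => exp (-C * x) * Q x :=
    antitone_of_deriv_nonpos (fun x => (hd x).differentiableAt) fun x => by
      rw [(hd x).deriv]
      exact mul_nonpos_of_nonneg_of_nonpos (exp_pos _).le (sub_nonpos.2 (hQle x))
  have h := hanti ht
  have hQ0 : Q 0 = 0 := by simp [hQ, h0, h1, h2, h3]
  simp only [hQ0, mul_zero] at h
  have hQt : Q t ≤ 0 := nonpos_of_mul_nonpos_right h (exp_pos _)
  have : u t ^ 2 ≤ 0 := by
    simp only [hQ] at hQt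
    linarith [sq_nonneg (u₁ t), sq_nonneg (u₂ t), sq_nonneg (u₃ t)]
  exact pow_eq_zero_iff two_ne_zero |>.1 (le_antisymm this (sq_nonneg _))

theorem hasDerivAt_abs_rpow_mul_self {q : ℝ} (hq : 0 < q) (x : ℝ) :
    HasDerivAt (fun x : ℝ => |x| ^ q * x) ((q + 1) * |x| ^ q) x := by
  rcases eq_or_ne x 0 with rfl | hx
  · rw [hasDerivAt_iff_tendsto_slope]
    have hcont : ContinuousAt (fun x : ℝ => |x| ^ q) 0 :=
      continuous_abs.continuousAt.rpow_const (Or.inr hq.le)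
    have h : Tendsto (fun x : ℝ => |x| ^ q) (𝓝[≠] 0) (𝓝 ((q + 1) * |(0 : ℝ)| ^ q)) := by
      have := hcont.tendsto.mono_left (nhdsWithin_le_nhds (s := {0}ᶜ))
      simpa [zero_rpow hq.ne'] using this
    refine h.congr' ?_
    filter_upwards [self_mem_nhdsWithin] with y hy
    have hy : y ≠ 0 := hy
    simp [slope_def_field, hy]
  · refine ((((hasDerivAt_abs hx).rpow_const (p := q) (Or.inl (abs_ne_zero.2 hx))).mul
      (hasDerivAt_id x))).congr_deriv ?_
    rw [rpow_sub_one (abs_ne_zero.2 hx)]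
    have h : (SignType.sign x : ℝ) * x = |x| := by simp
    have hx' := abs_ne_zero.2 hx
    simp only [id, mul_one]
    calc (SignType.sign x : ℝ) * q * (|x| ^ q / |x|) * x + |x| ^ q
        = (SignType.sign x : ℝ) * x * (q * (|x| ^ q / |x|)) + |x| ^ q := by ring
      _ = (q + 1) * |x| ^ q := by
        rw [h]
        field_simp

theorem monotone_abs_rpow_mul_self {q : ℝ} (hq : 0 < q) :
    Monotone fun x : ℝ => |x| ^ q * x :=
  monotone_of_deriv_nonneg (fun x => (hasDerivAt_abs_rpow_mul_self hq x).differentiableAt)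
    fun x => by
      rw [(hasDerivAt_abs_rpow_mul_self hq x).deriv]
      positivity

theorem abs_abs_rpow_mul_self_sub_le {q M : ℝ} (hq : 0 < q) {x y : ℝ} (hx : |x| ≤ M)
    (hy : |y| ≤ M) : |(|y| ^ q * y - |x| ^ q * x)| ≤ (q + 1) * M ^ q * |y - x| := by
  refine (convex_Icc (-M) M).norm_image_sub_le_of_norm_hasDerivWithin_le
    (f := fun x : ℝ => |x| ^ q * x)
    (fun z _ => (hasDerivAt_abs_rpow_mul_self hq z).hasDerivWithinAt) (fun z hz => ?_)
    (abs_le.1 hx) (abs_le.1 hy)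
  rw [norm_of_nonneg (by positivity)]
  have : |z| ≤ M := abs_le.2 hz
  gcongr

/-- **Lemma 7 (ii).** A bounded `C⁴` solution of `v'''' - A v'' - f(v) = 0` with `v(t₀) = 0`
is antisymmetric with respect to `t₀`. -/
theorem antisymmetry_at_zero (n : ℕ) (hn : 5 ≤ n) (v : ℝ → ℝ)
    (hreg : ContDiff ℝ 4 v)
    (hode : ∀ t : ℝ, iteratedDeriv 4 v t - Paper.A n * iteratedDeriv 2 v t
      - Paper.f n (v t) = 0)
    (hbd : ∃ M : ℝ, ∀ t : ℝ, |v t| ≤ M)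
    (t₀ : ℝ) (ht₀ : v t₀ = 0) :
    ∀ t : ℝ, v (t₀ - t) = -v (t₀ + t) := by
  obtain ⟨M, hM⟩ := hbd
  have hM0 : 0 ≤ M := (abs_nonneg _).trans (hM 0)
  have hn' : (0 : ℝ) < n - 4 := by
    have : (5 : ℝ) ≤ n := by exact_mod_cast hn
    linarith
  set q := Paper.p n - 1 with hq
  have hqpos : 0 < q := by
    rw [hq, Paper.p, sub_pos, lt_div_iff₀ hn']
    linarith
  set a : ℝ := (n : ℝ) / 2 with ha
  set b : ℝ := ((n : ℝ) - 4) / 2 with hb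
  have hA : Paper.A n = a ^ 2 + b ^ 2 := by rw [Paper.A, ha, hb]; ring
  have hB : Paper.B n = a ^ 2 * b ^ 2 := by rw [Paper.B, ha, hb]; ring
  have hv : ∀ k : ℕ, k < 4 → ∀ t, HasDerivAt (iteratedDeriv k v) (iteratedDeriv (k + 1) v t) t := by
    intro k hk t
    rw [iteratedDeriv_succ]
    exact (hreg.differentiable_iteratedDeriv k (by exact_mod_cast hk) t).hasDerivAt
  have hplus : ∀ k : ℕ, k < 4 → ∀ t, HasDerivAt (fun t => iteratedDeriv k v (t₀ + t))
      (iteratedDeriv (k + 1) v (t₀ + t)) t := fun k hk t => (hv k hk _).comp_const_add t₀ t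
  have hminus : ∀ k : ℕ, k < 4 → ∀ t, HasDerivAt (fun t => iteratedDeriv k v (t₀ - t))
      (-iteratedDeriv (k + 1) v (t₀ - t)) t := fun k hk t => (hv k hk _).comp_const_sub t₀ t
  set g : ℝ → ℝ := fun x => |x| ^ q * x with hg
  have hsol : ∀ t, iteratedDeriv 4 v t =
      (a ^ 2 + b ^ 2) * iteratedDeriv 2 v t - a ^ 2 * b ^ 2 * v t + g (v t) := fun t => by
    have := hode t
    rw [Paper.f, hA, hB] at this
    simp only [hg]
    linarith
  have hgneg : ∀ x, g (-x) = -g x := fun x => by simp [hg]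
  set u : ℝ → ℝ := fun t => v (t₀ + t) + v (t₀ - t) with hu_def
  set u₁ : ℝ → ℝ := fun t => iteratedDeriv 1 v (t₀ + t) - iteratedDeriv 1 v (t₀ - t) with hu₁_def
  set u₂ : ℝ → ℝ := fun t => iteratedDeriv 2 v (t₀ + t) + iteratedDeriv 2 v (t₀ - t) with hu₂_def
  set u₃ : ℝ → ℝ := fun t => iteratedDeriv 3 v (t₀ + t) - iteratedDeriv 3 v (t₀ - t) with hu₃_def
  set u₄ : ℝ → ℝ := fun t => iteratedDeriv 4 v (t₀ + t) + iteratedDeriv 4 v (t₀ - t) with hu₄_def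
  have hu : ∀ t, HasDerivAt u (u₁ t) t := fun t => by
    simpa [hu_def, hu₁_def, sub_eq_add_neg] using
      (hplus 0 (by norm_num) t).fun_add (hminus 0 (by norm_num) t)
  have hu₁ : ∀ t, HasDerivAt u₁ (u₂ t) t := fun t => by
    simpa only [sub_neg_eq_add] using (hplus 1 (by norm_num) t).fun_sub (hminus 1 (by norm_num) t)
  have hu₂ : ∀ t, HasDerivAt u₂ (u₃ t) t := fun t => by
    simpa only [← sub_eq_add_neg] using (hplus 2 (by norm_num) t).fun_add (hminus 2 (by norm_num) t)
  have hu₃ : ∀ t, HasDerivAt u₃ (u₄ t) t := fun t => by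
    simpa only [sub_neg_eq_add] using (hplus 3 (by norm_num) t).fun_sub (hminus 3 (by norm_num) t)
  have hrhs : ∀ t, u₄ t - (a ^ 2 + b ^ 2) * u₂ t + a ^ 2 * b ^ 2 * u t
      = g (v (t₀ + t)) - g (-v (t₀ - t)) := fun t => by
    simp only [hu₄_def, hu₂_def, hu_def, hsol, hgneg]
    ring
  have h0 : u 0 = 0 := by simp [hu_def, ht₀]
  have h1 : u₁ 0 = 0 := by simp [hu₁_def]
  have h3 : u₃ 0 = 0 := by simp [hu₃_def]
  have hmono : Monotone g := monotone_abs_rpow_mul_self hqpos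
  have habs : ∀ t, |u t| ≤ 2 * M := fun t => by
    have := abs_add_le (v (t₀ + t)) (v (t₀ - t))
    linarith [hM (t₀ + t), hM (t₀ - t)]
  have h2 : u₂ 0 = 0 := by
    refine le_antisymm
      (deriv_two_nonpos_of_bounded (a := a) (b := b) hu hu₁ hu₂ hu₃ (fun t ht => ?_)
        (fun t => (le_abs_self _).trans (habs t)) h0 h1 h3)
      (neg_nonpos.1 (deriv_two_nonpos_of_bounded (a := a) (b := b) (u := fun t => -u t)
        (u₂ := fun t => -u₂ t) (fun t => (hu t).neg) (fun t => (hu₁ t).neg)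
        (fun t => (hu₂ t).neg) (fun t => (hu₃ t).neg) (fun t ht => ?_)
        (fun t => (neg_le_abs _).trans (habs t)) (by simp [h0]) (by simp [h1]) (by simp [h3])))
    · rw [hrhs t]
      exact sub_nonneg.2 (hmono (by simp only [hu_def] at ht; linarith))
    · have := hmono (show v (t₀ + t) ≤ -v (t₀ - t) by simp only [hu_def] at ht; linarith)
      linarith [hrhs t]
  have hzero : ∀ t, 0 ≤ t → u t = 0 := fun t ht => by
    refine eq_zero_of_abs_deriv_four_le (K := a ^ 2 + b ^ 2)
      (N := a ^ 2 * b ^ 2 + (q + 1) * M ^ q) (by positivity) (by positivity)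
      hu hu₁ hu₂ hu₃ (fun x => ?_) h0 h1 h2 h3 ht
    have hlip : |g (v (t₀ + x)) - g (-v (t₀ - x))| ≤ (q + 1) * M ^ q * |u x| := by
      simpa [hu_def, hg] using abs_abs_rpow_mul_self_sub_le hqpos
        (x := -v (t₀ - x)) (by simpa using hM (t₀ - x)) (hM (t₀ + x))
    have hdecomp : u₄ x = (a ^ 2 + b ^ 2) * u₂ x + -(a ^ 2 * b ^ 2 * u x)
        + (g (v (t₀ + x)) - g (-v (t₀ - x))) := by linarith [hrhs x]
    have htri := abs_add_three ((a ^ 2 + b ^ 2) * u₂ x) (-(a ^ 2 * b ^ 2 * u x))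
      (g (v (t₀ + x)) - g (-v (t₀ - x)))
    rw [← hdecomp, abs_neg, abs_mul, abs_mul (a ^ 2 * b ^ 2),
      abs_of_nonneg (show 0 ≤ a ^ 2 + b ^ 2 by positivity),
      abs_of_nonneg (show 0 ≤ a ^ 2 * b ^ 2 by positivity)] at htri
    linarith
  intro t
  rcases le_total 0 t with ht | ht
  · have := hzero t ht
    simp only [hu_def] at this
    linarith
  · have := hzero (-t) (neg_nonneg.2 ht)
    simp only [hu_def, sub_neg_eq_add, ← sub_eq_add_neg] at this
    linarith
end

section
/- Let v ∈ C⁴(ℝ) be a positive solution of the ODE v'''' − A·v'' − f(v) = 0 on ℝ with lim_{|t|→∞} v(t) = 0. Then there exists T ∈ ℝ such that v(t) = c_n·(2·cosh(t − T))^(−(n−4)/2) for all t ∈ ℝ. -/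
open Real Filter

namespace Homoclinic

open Set

theorem le_of_hasDerivAt_nonneg {g g' : ℝ → ℝ} {a b : ℝ} (hab : a ≤ b)
    (hg : ∀ x ∈ Icc a b, HasDerivAt g (g' x) x) (h0 : ∀ x ∈ Icc a b, 0 ≤ g' x) :
    g a ≤ g b := by
  refine monotoneOn_of_hasDerivWithinAt_nonneg (D := Icc a b) (f' := g') (convex_Icc a b)
    (fun x hx => (hg x hx).continuousAt.continuousWithinAt)
    (fun x hx => (hg x (interior_subset hx)).hasDerivWithinAt)
    (fun x hx => h0 x (interior_subset hx)) (left_mem_Icc.2 hab) (right_mem_Icc.2 hab) hab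

theorem hasDerivAt_exp_const_mul (k t : ℝ) :
    HasDerivAt (fun s => exp (k * s)) (k * exp (k * t)) t := by
  have h := ((hasDerivAt_id t).const_mul k).exp
  simpa [mul_comm] using h

/-- A function whose second derivative is bounded below by a positive constant on a half-line is
unbounded above. -/
theorem exists_gt_of_second_deriv_ge {u u1 u2 : ℝ → ℝ} {t₀ δ : ℝ} (hδ : 0 < δ)
    (hu : ∀ t, HasDerivAt u (u1 t) t) (hu1 : ∀ t, HasDerivAt u1 (u2 t) t)
    (h : ∀ t, t₀ ≤ t → δ ≤ u2 t) (M : ℝ) : ∃ t, t₀ ≤ t ∧ M < u t := by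
  have h1 : ∀ t, t₀ ≤ t → u1 t₀ + δ * (t - t₀) ≤ u1 t := by
    intro t ht
    have := le_of_hasDerivAt_nonneg (g := fun s => u1 s - δ * (s - t₀))
      (g' := fun s => u2 s - δ) ht
      (fun x _ => by
        exact ((hu1 x).sub (((hasDerivAt_id x).sub_const t₀).const_mul δ)).congr_deriv (by simp))
      (fun x hx => by simpa using h x hx.1)
    simp only [sub_self, mul_zero, sub_zero] at this
    linarith
  have h2 : ∀ t, t₀ ≤ t → u t₀ + u1 t₀ * (t - t₀) + δ / 2 * (t - t₀) ^ 2 ≤ u t := by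
    intro t ht
    have := le_of_hasDerivAt_nonneg
      (g := fun s => u s - (u1 t₀ * (s - t₀) + δ / 2 * (s - t₀) ^ 2))
      (g' := fun s => u1 s - (u1 t₀ + δ * (s - t₀))) ht
      (fun x _ => by
        have hx := (hasDerivAt_id x).sub_const t₀
        have := (hu x).sub ((hx.const_mul (u1 t₀)).add ((hx.pow 2).const_mul (δ / 2)))
        refine this.congr_deriv ?_
        simp
        ring)
      (fun x hx => by simpa using h1 x hx.1)
    simp only [sub_self] at this
    linarith
  set x : ℝ := 1 + 2 * (|u1 t₀| + |M - u t₀|) / δ with hx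
  have hx1 : 1 ≤ x := by
    have : 0 ≤ 2 * (|u1 t₀| + |M - u t₀|) / δ := by positivity
    linarith
  have hδx : δ * x = δ + 2 * (|u1 t₀| + |M - u t₀|) := by
    rw [hx]; field_simp
  refine ⟨t₀ + x, by linarith, ?_⟩
  have h3 := h2 (t₀ + x) (by linarith)
  have e : t₀ + x - t₀ = x := by ring
  rw [e] at h3
  have h4 : |M - u t₀| + δ / 2 ≤ u1 t₀ + δ / 2 * x := by
    have := neg_abs_le (u1 t₀)
    linarith
  have h5 : |M - u t₀| + δ / 2 ≤ x * (u1 t₀ + δ / 2 * x) := by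
    have h0 : 0 ≤ |M - u t₀| + δ / 2 := by positivity
    nlinarith
  have := le_abs_self (M - u t₀)
  nlinarith

/-- Forward growth for `s'' ≥ κ² s`. -/
theorem growth_of_second_deriv_ge {s s1 s2 : ℝ → ℝ} {t₀ κ : ℝ} (hκ : 0 < κ)
    (hs : ∀ t, HasDerivAt s (s1 t) t) (hs1 : ∀ t, HasDerivAt s1 (s2 t) t)
    (h : ∀ t, t₀ ≤ t → κ ^ 2 * s t ≤ s2 t) (h0 : 0 < s t₀) (h1 : 0 ≤ s1 t₀) :
    ∀ t, t₀ ≤ t → s t₀ ≤ s t ∧ 0 ≤ s1 t := by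
  have e1 : ∀ t, t₀ ≤ t → 0 ≤ s1 t + κ * s t := by
    intro t ht
    have := le_of_hasDerivAt_nonneg (g := fun r => (s1 r + κ * s r) * exp (-κ * r))
      (g' := fun r => (s2 r - κ ^ 2 * s r) * exp (-κ * r)) ht
      (fun x _ => by
        refine (((hs1 x).add ((hs x).const_mul κ)).mul
          (hasDerivAt_exp_const_mul (-κ) x)).congr_deriv ?_
        simp
        ring)
      (fun x hx => mul_nonneg (by linarith [h x hx.1]) (exp_pos _).le)
    have h3 : 0 ≤ (s1 t₀ + κ * s t₀) * exp (-κ * t₀) := by positivity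
    exact nonneg_of_mul_nonneg_left (h3.trans this) (exp_pos _)
  have e2 : ∀ t, t₀ ≤ t → 0 < s t := by
    intro t ht
    have := le_of_hasDerivAt_nonneg (g := fun r => s r * exp (κ * r))
      (g' := fun r => (s1 r + κ * s r) * exp (κ * r)) ht
      (fun x _ => by
        refine ((hs x).mul (hasDerivAt_exp_const_mul κ x)).congr_deriv ?_
        ring)
      (fun x hx => mul_nonneg (e1 x hx.1) (exp_pos _).le)
    have h3 : 0 < s t₀ * exp (κ * t₀) := by positivity
    exact pos_of_mul_pos_left (h3.trans_le this) (exp_pos _).le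
  have e3 : ∀ t, t₀ ≤ t → 0 ≤ s1 t := by
    intro t ht
    refine h1.trans (le_of_hasDerivAt_nonneg ht (fun x _ => hs1 x) fun x hx => ?_)
    exact le_trans (mul_nonneg (sq_nonneg κ) (e2 x hx.1).le) (h x hx.1)
  exact fun t ht => ⟨le_of_hasDerivAt_nonneg ht (fun x _ => hs x) fun x hx => e3 x hx.1, e3 t ht⟩

theorem hasDerivAt_min_zero_sq (x : ℝ) :
    HasDerivAt (fun y : ℝ => (min y 0) ^ 2) (2 * min x 0) x := by
  rw [hasDerivAt_iff_isLittleO]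
  refine Asymptotics.IsBigO.trans_isLittleO (g := fun y => (y - x) ^ 2) ?_ ?_
  · refine Asymptotics.IsBigO.of_bound 1 (Filter.Eventually.of_forall fun y => ?_)
    rw [one_mul, norm_eq_abs, norm_eq_abs, abs_of_nonneg (sq_nonneg (y - x)), abs_le, smul_eq_mul]
    rcases le_total x 0 with hx | hx <;> rcases le_total y 0 with hy | hy <;>
      simp only [hx, hy, min_eq_left, min_eq_right] <;> constructor <;> nlinarith
  · have h : Tendsto (fun y : ℝ => y - x) (nhds x) (nhds 0) := by
      have : Continuous fun y : ℝ => y - x := by fun_prop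
      simpa using this.tendsto x
    simpa [pow_two] using
      ((Asymptotics.isLittleO_one_iff ℝ).2 h).mul_isBigO (Asymptotics.isBigO_refl (fun y => y - x) _)

/-- The cone of nonnegative data is forward invariant for
`z'' = β² z + w`, `w'' = α² w + r`, provided `r` is bounded below by a multiple of the negative
part of `z`. -/
theorem cone_invariant {z z1 w w1 r : ℝ → ℝ} {β α K t₀ : ℝ} (hK : 0 ≤ K)
    (dz : ∀ t, HasDerivAt z (z1 t) t) (dz1 : ∀ t, HasDerivAt z1 (β ^ 2 * z t + w t) t)
    (dw : ∀ t, HasDerivAt w (w1 t) t) (dw1 : ∀ t, HasDerivAt w1 (α ^ 2 * w t + r t) t)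
    (hr : ∀ t, K * min (z t) 0 ≤ r t)
    (h0 : 0 ≤ z t₀) (h1 : 0 ≤ z1 t₀) (h2 : 0 ≤ w t₀) (h3 : 0 ≤ w1 t₀) :
    ∀ t, t₀ ≤ t → 0 ≤ z t ∧ 0 ≤ z1 t ∧ 0 ≤ w t ∧ 0 ≤ w1 t := by
  intro t ht
  set L : ℝ := 2 + β ^ 2 + α ^ 2 + K with hL
  have key := le_of_hasDerivAt_nonneg
    (g := fun s => -((min (z s) 0 ^ 2 + min (z1 s) 0 ^ 2 + min (w s) 0 ^ 2 + min (w1 s) 0 ^ 2)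
      * exp (-L * s)))
    (g' := fun s => (L * (min (z s) 0 ^ 2 + min (z1 s) 0 ^ 2 + min (w s) 0 ^ 2 + min (w1 s) 0 ^ 2)
      - 2 * (min (z s) 0 * z1 s + min (z1 s) 0 * (β ^ 2 * z s + w s)
        + min (w s) 0 * w1 s + min (w1 s) 0 * (α ^ 2 * w s + r s))) * exp (-L * s)) ht
    (fun x _ => by
      have d1 := (hasDerivAt_min_zero_sq (z x)).comp x (dz x)
      have d2 := (hasDerivAt_min_zero_sq (z1 x)).comp x (dz1 x)
      have d3 := (hasDerivAt_min_zero_sq (w x)).comp x (dw x)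
      have d4 := (hasDerivAt_min_zero_sq (w1 x)).comp x (dw1 x)
      refine ((((d1.add d2).add d3).add d4).mul (hasDerivAt_exp_const_mul (-L) x)).neg.congr_deriv ?_
      simp
      ring)
    (fun x _ => by
      refine mul_nonneg ?_ (exp_pos _).le
      have a0 := min_le_right (z x) 0
      have a1 := min_le_right (z1 x) 0
      have a2 := min_le_right (w x) 0
      have a3 := min_le_right (w1 x) 0
      have b0 := min_le_left (z x) 0
      have b1 := min_le_left (z1 x) 0
      have b2 := min_le_left (w x) 0
      have b3 := min_le_left (w1 x) 0
      have c := hr x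
      generalize min (z x) 0 = m0 at *
      generalize min (z1 x) 0 = m1 at *
      generalize min (w x) 0 = m2 at *
      generalize min (w1 x) 0 = m3 at *
      have e0 : m0 * z1 x ≤ m0 * m1 := mul_le_mul_of_nonpos_left b1 a0
      have e1 : m1 * (β ^ 2 * z x + w x) ≤ m1 * (β ^ 2 * m0 + m2) :=
        mul_le_mul_of_nonpos_left (by nlinarith [sq_nonneg β]) a1
      have e2 : m2 * w1 x ≤ m2 * m3 := mul_le_mul_of_nonpos_left b3 a2
      have e3 : m3 * (α ^ 2 * w x + r x) ≤ m3 * (α ^ 2 * m2 + K * m0) :=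
        mul_le_mul_of_nonpos_left (by nlinarith [sq_nonneg α]) a3
      have f1 : 0 ≤ β ^ 2 * (m0 - m1) ^ 2 := by positivity
      have f2 : 0 ≤ α ^ 2 * (m2 - m3) ^ 2 := by positivity
      have f3 : 0 ≤ K * (m0 - m3) ^ 2 := by positivity
      have f4 : 0 ≤ (β ^ 2 + K) * (m2 ^ 2) := by positivity
      have f5 : 0 ≤ (α ^ 2 + K) * (m1 ^ 2) := by positivity
      have f6 : 0 ≤ β ^ 2 * m3 ^ 2 + α ^ 2 * m0 ^ 2 := by positivity
      rw [hL]
      nlinarith [sq_nonneg (m0 - m1), sq_nonneg (m1 - m2), sq_nonneg (m2 - m3)])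
  simp only [min_eq_right h0, min_eq_right h1, min_eq_right h2, min_eq_right h3] at key
  have key' : min (z t) 0 ^ 2 + min (z1 t) 0 ^ 2 + min (w t) 0 ^ 2 + min (w1 t) 0 ^ 2 ≤ 0 := by
    have := exp_pos (-L * t)
    by_contra! hc
    nlinarith [mul_pos hc this]
  have nn : ∀ y : ℝ, min y 0 ^ 2 ≤ 0 → 0 ≤ y := by
    intro y hy
    have h4 : min y 0 = 0 := by
      have := le_antisymm hy (sq_nonneg _)
      exact pow_eq_zero_iff (two_ne_zero) |>.1 this
    exact min_eq_right_iff.1 h4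
  have p0 := sq_nonneg (min (z t) 0)
  have p1 := sq_nonneg (min (z1 t) 0)
  have p2 := sq_nonneg (min (w t) 0)
  have p3 := sq_nonneg (min (w1 t) 0)
  exact ⟨nn _ (by linarith), nn _ (by linarith), nn _ (by linarith), nn _ (by linarith)⟩

/-- A trajectory that enters the nonnegative cone and stays bounded vanishes from then on. -/
theorem eq_zero_of_cone {z z1 w w1 r : ℝ → ℝ} {β α K M t₀ : ℝ} (hβ : 0 < β) (hK : 0 ≤ K)
    (dz : ∀ t, HasDerivAt z (z1 t) t) (dz1 : ∀ t, HasDerivAt z1 (β ^ 2 * z t + w t) t)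
    (dw : ∀ t, HasDerivAt w (w1 t) t) (dw1 : ∀ t, HasDerivAt w1 (α ^ 2 * w t + r t) t)
    (hr : ∀ t, K * min (z t) 0 ≤ r t) (hM : ∀ t, z t ≤ M)
    (h0 : 0 ≤ z t₀) (h1 : 0 ≤ z1 t₀) (h2 : 0 ≤ w t₀) (h3 : 0 ≤ w1 t₀) :
    (∀ t, t₀ ≤ t → z t = 0) ∧ w t₀ = 0 ∧ w1 t₀ = 0 := by
  have hc := cone_invariant hK dz dz1 dw dw1 hr h0 h1 h2 h3
  have zmono : ∀ a b, t₀ ≤ a → a ≤ b → z a ≤ z b := fun a b ha hab =>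
    le_of_hasDerivAt_nonneg hab (fun x _ => dz x) fun x hx => (hc x (ha.trans hx.1)).2.1
  have wmono : ∀ a b, t₀ ≤ a → a ≤ b → w a ≤ w b := fun a b ha hab =>
    le_of_hasDerivAt_nonneg hab (fun x _ => dw x) fun x hx => (hc x (ha.trans hx.1)).2.2.2
  have w1mono : ∀ a b, t₀ ≤ a → a ≤ b → w1 a ≤ w1 b := fun a b ha hab =>
    le_of_hasDerivAt_nonneg hab (fun x _ => dw1 x) fun x hx => by
      obtain ⟨c0, -, c2, -⟩ := hc x (ha.trans hx.1)
      have := hr x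
      rw [min_eq_right c0, mul_zero] at this
      positivity
  have key : ∀ t, t₀ ≤ t → β ^ 2 * z t + w t = 0 := by
    intro t ht
    by_contra hne
    obtain ⟨c0, -, c2, -⟩ := hc t ht
    have hpos : 0 < β ^ 2 * z t + w t := lt_of_le_of_ne (by positivity) (Ne.symm hne)
    obtain ⟨s, -, hs⟩ := exists_gt_of_second_deriv_ge hpos dz dz1 (t₀ := t)
      (fun s hs => by
        have := mul_le_mul_of_nonneg_left (zmono t s ht hs) (sq_nonneg β)
        linarith [wmono t s ht hs]) M
    exact absurd (hM s) (not_le.2 hs)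
  have hz : ∀ t, t₀ ≤ t → z t = 0 := by
    intro t ht
    obtain ⟨c0, -, c2, -⟩ := hc t ht
    have := key t ht
    have hb : 0 < β ^ 2 := by positivity
    nlinarith
  have hw : ∀ t, t₀ ≤ t → w t = 0 := by
    intro t ht
    have := key t ht
    rw [hz t ht] at this
    linarith
  refine ⟨hz, hw t₀ le_rfl, le_antisymm ?_ h3⟩
  have := le_of_hasDerivAt_nonneg (g := fun s => w s - w1 t₀ * s) (g' := fun s => w1 s - w1 t₀)
    (a := t₀) (b := t₀ + 1) (by linarith)
    (fun x _ => ((dw x).sub ((hasDerivAt_id x).const_mul (w1 t₀))).congr_deriv (by simp))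
    (fun x hx => by linarith [w1mono t₀ x le_rfl hx.1])
  simp only [hw t₀ le_rfl, hw (t₀ + 1) (by linarith)] at this
  linarith

/-- Positive homoclinic solutions of `(D² - (β + 2)²) (D² - β²) v = v ^ (1 + 4 / β)`, written as a
first-order system with `v1 = v'`, `w = v'' - β² v` and `w1 = w'`. -/
structure IsHomoclinic (β : ℝ) (v v1 w w1 : ℝ → ℝ) : Prop where
  dv : ∀ t, HasDerivAt v (v1 t) t
  dv1 : ∀ t, HasDerivAt v1 (β ^ 2 * v t + w t) t
  dw : ∀ t, HasDerivAt w (w1 t) t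
  dw1 : ∀ t, HasDerivAt w1 ((β + 2) ^ 2 * w t + v t ^ (1 + 4 / β)) t
  pos : ∀ t, 0 < v t
  top : Tendsto v atTop (nhds 0)
  bot : Tendsto v atBot (nhds 0)

theorem _root_.HasDerivAt.comp_neg_real {g : ℝ → ℝ} {g' t : ℝ} (h : HasDerivAt g g' (-t)) :
    HasDerivAt (fun s => g (-s)) (-g') t :=
  (h.comp t (hasDerivAt_neg t)).congr_deriv (by simp)

namespace IsHomoclinic

variable {β : ℝ} {v v1 w w1 u u1 x x1 : ℝ → ℝ}

theorem reflect (h : IsHomoclinic β v v1 w w1) :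
    IsHomoclinic β (fun t => v (-t)) (fun t => -v1 (-t)) (fun t => w (-t)) (fun t => -w1 (-t)) where
  dv t := (h.dv (-t)).comp_neg_real
  dv1 t := ((h.dv1 (-t)).comp_neg_real.neg).congr_deriv (by simp)
  dw t := (h.dw (-t)).comp_neg_real
  dw1 t := ((h.dw1 (-t)).comp_neg_real.neg).congr_deriv (by simp)
  pos t := h.pos (-t)
  top := h.bot.comp tendsto_neg_atTop_atBot
  bot := h.top.comp tendsto_neg_atBot_atTop

theorem exists_bound (h : IsHomoclinic β v v1 w w1) : ∃ M, 0 < M ∧ ∀ t, v t ≤ M := by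
  obtain ⟨b, hb⟩ := eventually_atTop.1 (h.top.eventually (gt_mem_nhds zero_lt_one))
  obtain ⟨a, ha⟩ := eventually_atBot.1 (h.bot.eventually (gt_mem_nhds zero_lt_one))
  have hc : Continuous v := continuous_iff_continuousAt.2 fun t => (h.dv t).continuousAt
  obtain ⟨C, hC⟩ := (isCompact_Icc (a := a) (b := b)).exists_bound_of_continuousOn hc.continuousOn
  refine ⟨max C 1, by positivity, fun t => ?_⟩
  rcases le_total b t with h1 | h1
  · exact (hb t h1).le.trans (le_max_right _ _)
  rcases le_total t a with h2 | h2
  · exact (ha t h2).le.trans (le_max_right _ _)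
  · exact ((le_abs_self _).trans (hC t ⟨h2, h1⟩)).trans (le_max_left _ _)

/-- Maximum principle: `v'' ≤ β² v`. -/
theorem w_nonpos (hβ : 0 < β) (h : IsHomoclinic β v v1 w w1) (t : ℝ) : w t ≤ 0 := by
  have key : ∀ {v v1 w w1 : ℝ → ℝ}, IsHomoclinic β v v1 w w1 → ∀ t, 0 < w t → 0 ≤ w1 t → False := by
    intro v v1 w w1 h t h0 h1
    obtain ⟨M, -, hM⟩ := h.exists_bound
    have hg := growth_of_second_deriv_ge (κ := β + 2) (by linarith) h.dw h.dw1
      (fun s _ => by linarith [rpow_pos_of_pos (h.pos s) (1 + 4 / β)]) h0 h1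
    obtain ⟨s, -, hs⟩ := exists_gt_of_second_deriv_ge h0 h.dv h.dv1 (t₀ := t)
      (fun s hs => by
        have := mul_nonneg (sq_nonneg β) (h.pos s).le
        linarith [(hg s hs).1]) M
    exact absurd (hM s) (not_le.2 hs)
  by_contra! hc
  rcases le_total 0 (w1 t) with h1 | h1
  · exact key h t hc h1
  · exact key h.reflect (-t) (by simpa using hc) (by simpa using h1)

theorem deriv_le (hβ : 0 < β) (h : IsHomoclinic β v v1 w w1) (t : ℝ) : v1 t ≤ β * v t := by
  by_contra! hc
  set δ := (v1 t - β * v t) * exp (β * t) with hδ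
  have hδ0 : 0 < δ := mul_pos (by linarith) (exp_pos _)
  have h1 : ∀ s, s ≤ t → δ ≤ (v1 s - β * v s) * exp (β * s) := by
    intro s hs
    have := le_of_hasDerivAt_nonneg (g := fun r => -((v1 r - β * v r) * exp (β * r)))
      (g' := fun r => -w r * exp (β * r)) hs
      (fun r _ => by
        refine (((h.dv1 r).sub ((h.dv r).const_mul β)).mul
          (hasDerivAt_exp_const_mul β r)).neg.congr_deriv ?_
        simp
        ring)
      (fun r _ => mul_nonneg (by linarith [h.w_nonpos hβ r]) (exp_pos _).le)
    linarith
  have h2 : ∀ s, s ≤ t → δ * exp (-(β * t)) ≤ v1 s := by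
    intro s hs
    have e1 := h1 s hs
    have e2 : exp (β * s) ≤ exp (β * t) := exp_le_exp.2 (by nlinarith)
    have e3 := mul_nonneg hβ.le (h.pos s).le
    have e4 : 0 < v1 s - β * v s := pos_of_mul_pos_left (hδ0.trans_le e1) (exp_pos _).le
    have e5 : δ ≤ v1 s * exp (β * t) :=
      e1.trans ((mul_le_mul_of_nonneg_left e2 e4.le).trans
        (mul_le_mul_of_nonneg_right (by linarith) (exp_pos _).le))
    rw [exp_neg, ← div_eq_mul_inv, div_le_iff₀ (exp_pos _)]
    exact e5
  set η := δ * exp (-(β * t)) with hη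
  have hη0 : 0 < η := mul_pos hδ0 (exp_pos _)
  have hst : t - v t / η ≤ t := by
    have := div_pos (h.pos t) hη0
    linarith
  have := le_of_hasDerivAt_nonneg (g := fun r => v r - η * r) (g' := fun r => v1 r - η) hst
    (fun r _ => ((h.dv r).sub ((hasDerivAt_id r).const_mul η)).congr_deriv (by simp))
    (fun r hr => by linarith [h2 r hr.2])
  have e : η * (t - v t / η) = η * t - v t := by field_simp
  simp only [e] at this
  linarith [h.pos (t - v t / η)]

theorem neg_le_deriv (hβ : 0 < β) (h : IsHomoclinic β v v1 w w1) (t : ℝ) : -(β * v t) ≤ v1 t := by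
  have := h.reflect.deriv_le hβ (-t)
  simp only [neg_neg] at this
  linarith

theorem deriv_sq_le (hβ : 0 < β) (h : IsHomoclinic β v v1 w w1) (t : ℝ) :
    v1 t ^ 2 ≤ β ^ 2 * v t ^ 2 := by
  have h1 := h.deriv_le hβ t
  have h2 := h.neg_le_deriv hβ t
  nlinarith

/-- Quantitative lower bound `v'' ≥ β² v - C v ^ (1 + 1 / β)`. -/
theorem exists_le_w (hβ : 0 < β) (h : IsHomoclinic β v v1 w w1) :
    ∃ C, 0 < C ∧ ∀ t, -(C * v t ^ (1 + 1 / β)) ≤ w t := by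
  obtain ⟨M, hM0, hM⟩ := h.exists_bound
  set C := M ^ (3 / β) / (2 * β + 3) with hC
  have hC0 : 0 < C := by positivity
  have key : ∀ {v v1 w w1 : ℝ → ℝ}, IsHomoclinic β v v1 w w1 → (∀ t, v t ≤ M) →
      ∀ t, 0 < -(w t + C * v t ^ (1 + 1 / β)) →
        0 ≤ -(w1 t + C * ((1 + 1 / β) * v t ^ (1 / β) * v1 t)) → False := by
    intro v v1 w w1 h hM t h0 h1
    have d0 : ∀ t, HasDerivAt (fun t => -(w t + C * v t ^ (1 + 1 / β)))
        (-(w1 t + C * ((1 + 1 / β) * v t ^ (1 / β) * v1 t))) t := by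
      intro t
      refine ((h.dw t).add (((h.dv t).rpow_const (p := 1 + 1 / β)
        (Or.inl (h.pos t).ne')).const_mul C)).neg.congr_deriv ?_
      rw [show 1 + 1 / β - 1 = 1 / β by ring]
      ring
    have d1 : ∀ t, HasDerivAt (fun t => -(w1 t + C * ((1 + 1 / β) * v t ^ (1 / β) * v1 t)))
        (-((β + 2) ^ 2 * w t + v t ^ (1 + 4 / β) + C * (1 + 1 / β) *
          (1 / β * v t ^ (1 / β - 1) * v1 t ^ 2 + v t ^ (1 / β) * (β ^ 2 * v t + w t)))) t := by
      intro t
      refine ((h.dw1 t).add (((((h.dv t).rpow_const (p := 1 / β)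
        (Or.inl (h.pos t).ne')).const_mul (1 + 1 / β)).mul (h.dv1 t)).const_mul C)).neg.congr_deriv ?_
      ring
    have d2 : ∀ t, (β + 2) ^ 2 * -(w t + C * v t ^ (1 + 1 / β)) ≤
        -((β + 2) ^ 2 * w t + v t ^ (1 + 4 / β) + C * (1 + 1 / β) *
          (1 / β * v t ^ (1 / β - 1) * v1 t ^ 2 + v t ^ (1 / β) * (β ^ 2 * v t + w t))) := by
      intro t
      have hv := h.pos t
      set a := v t ^ (1 / β - 1) with ha
      have ha0 : 0 < a := rpow_pos_of_pos hv _
      have r1 : v t ^ (1 / β) = a * v t := by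
        rw [ha, ← rpow_add_one hv.ne']; congr 1; ring
      have r2 : v t ^ (1 + 1 / β) = a * v t ^ 2 := by
        rw [add_comm, rpow_add_one hv.ne', r1]; ring
      have r3 : v t ^ (1 + 4 / β) = a * v t ^ 2 * v t ^ (3 / β) := by
        rw [← r2, ← rpow_add hv]; congr 1; ring
      have r4 : v t ^ (3 / β) ≤ C * (2 * β + 3) := by
        rw [hC, div_mul_cancel₀ _ (by positivity)]
        exact rpow_le_rpow hv.le (hM t) (by positivity)
      have r5 : v t ^ (1 + 4 / β) ≤ a * v t ^ 2 * (C * (2 * β + 3)) := by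
        rw [r3]; gcongr
      have r6 : 1 / β * a * v1 t ^ 2 ≤ 1 / β * a * (β ^ 2 * v t ^ 2) := by
        gcongr
        exact h.deriv_sq_le hβ t
      have r7 : a * v t * (β ^ 2 * v t + w t) ≤ a * v t * (β ^ 2 * v t) := by
        gcongr
        linarith [h.w_nonpos hβ t]
      have r8 : C * (1 + 1 / β) * (1 / β * a * v1 t ^ 2 + a * v t * (β ^ 2 * v t + w t)) ≤
          C * (1 + 1 / β) * (1 / β * a * (β ^ 2 * v t ^ 2) + a * v t * (β ^ 2 * v t)) := by
        gcongr
      have r9 : C * (1 + 1 / β) * (1 / β * a * (β ^ 2 * v t ^ 2) + a * v t * (β ^ 2 * v t)) =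
          C * (β + 1) ^ 2 * (a * v t ^ 2) := by
        field_simp
        ring
      rw [r1, r2]
      nlinarith
    have hg := growth_of_second_deriv_ge (κ := β + 2) (by linarith) d0 d1 (fun t _ => d2 t) h0 h1
    obtain ⟨s, hts, hs⟩ := exists_gt_of_second_deriv_ge (t₀ := t)
      (mul_pos (show 0 < (β + 2) ^ 2 by positivity) h0) d0 d1
      (fun s hs => (mul_le_mul_of_nonneg_left (hg s hs).1 (by positivity)).trans (d2 s))
      (β ^ 2 * M + 1)
    have hs0 : 0 < β ^ 2 * M + 1 := by positivity
    have hg' := growth_of_second_deriv_ge (κ := β + 2) (by linarith) d0 d1 (fun t _ => d2 t)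
      (hs0.trans hs) (hg s hts).2
    obtain ⟨r, -, hr⟩ := exists_gt_of_second_deriv_ge (t₀ := s) (u := fun r => -v r)
      (u1 := fun r => -v1 r) zero_lt_one (fun r => (h.dv r).neg) (fun r => (h.dv1 r).neg)
      (fun r hr => by
        have e1 := (hg' r hr).1
        have e2 := mul_le_mul_of_nonneg_left (hM r) (sq_nonneg β)
        have e3 : 0 < C * v r ^ (1 + 1 / β) := mul_pos hC0 (rpow_pos_of_pos (h.pos r) _)
        linarith) 0
    linarith [h.pos r]
  refine ⟨C, hC0, fun t => ?_⟩
  by_contra! hc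
  rcases le_total 0 (-(w1 t + C * ((1 + 1 / β) * v t ^ (1 / β) * v1 t))) with h1 | h1
  · exact key h hM t (by linarith) h1
  · refine key h.reflect (fun t => hM (-t)) (-t) ?_ ?_
    · simp only [neg_neg]; linarith
    · simp only [neg_neg]; linarith

theorem exists_abs_w_le (hβ : 0 < β) (h : IsHomoclinic β v v1 w w1) :
    ∃ N, ∀ t, |w t| ≤ N := by
  obtain ⟨M, hM0, hM⟩ := h.exists_bound
  obtain ⟨C, hC0, hC⟩ := h.exists_le_w hβ
  refine ⟨C * M ^ (1 + 1 / β), fun t => ?_⟩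
  have h1 : v t ^ (1 + 1 / β) ≤ M ^ (1 + 1 / β) := rpow_le_rpow (h.pos t).le (hM t) (by positivity)
  have h2 : C * v t ^ (1 + 1 / β) ≤ C * M ^ (1 + 1 / β) := by gcongr
  have h3 : 0 < C * v t ^ (1 + 1 / β) := mul_pos hC0 (rpow_pos_of_pos (h.pos t) _)
  rw [abs_le]
  exact ⟨by linarith [hC t], by linarith [h.w_nonpos hβ t]⟩

theorem exists_abs_w1_le (hβ : 0 < β) (h : IsHomoclinic β v v1 w w1) :
    ∃ N, ∀ t, |w1 t| ≤ N := by
  obtain ⟨M, hM0, hM⟩ := h.exists_bound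
  obtain ⟨N, hN⟩ := h.exists_abs_w_le hβ
  set S := (β + 2) ^ 2 * N + M ^ (1 + 4 / β) with hS
  have hd : ∀ t, |(β + 2) ^ 2 * w t + v t ^ (1 + 4 / β)| ≤ S := by
    intro t
    have h1 : v t ^ (1 + 4 / β) ≤ M ^ (1 + 4 / β) :=
      rpow_le_rpow (h.pos t).le (hM t) (by positivity)
    have h2 := rpow_pos_of_pos (h.pos t) (1 + 4 / β)
    refine (abs_add_le _ _).trans ?_
    rw [abs_mul, abs_of_pos h2, abs_of_nonneg (sq_nonneg _)]
    have := mul_le_mul_of_nonneg_left (hN t) (sq_nonneg (β + 2))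
    linarith
  refine ⟨2 * N + S, fun t => ?_⟩
  obtain ⟨c, hc, hc'⟩ := exists_hasDerivAt_eq_slope w w1 (show t < t + 1 by linarith)
    (fun x _ => (h.dw x).continuousAt.continuousWithinAt) (fun x _ => h.dw x)
  have e1 : |w1 c| ≤ 2 * N := by
    rw [hc', add_sub_cancel_left, div_one]
    have := abs_sub (w (t + 1)) (w t)
    linarith [hN t, hN (t + 1)]
  have e2 : |w1 c - w1 t| ≤ S := by
    obtain ⟨b, hb, hb'⟩ := exists_hasDerivAt_eq_slope w1 _ hc.1
      (fun x _ => (h.dw1 x).continuousAt.continuousWithinAt) (fun x _ => h.dw1 x)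
    have hct : 0 < c - t := by linarith [hc.1]
    rw [eq_div_iff hct.ne'] at hb'
    rw [← hb', abs_mul, abs_of_pos hct]
    have h0 := abs_nonneg ((β + 2) ^ 2 * w b + v b ^ (1 + 4 / β))
    nlinarith [hd b, hc.2]
  have e3 : |w1 t| ≤ |w1 c| + |w1 c - w1 t| := by
    have := abs_sub (w1 c) (w1 c - w1 t)
    rwa [sub_sub_cancel] at this
  linarith

theorem rpow_sub_rpow_le {p M a b : ℝ} (hp : 1 ≤ p) (ha : 0 < a) (hab : a ≤ b) (hb : b ≤ M) :
    b ^ p - a ^ p ≤ p * M ^ (p - 1) * (b - a) := by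
  have := le_of_hasDerivAt_nonneg (g := fun y => p * M ^ (p - 1) * y - y ^ p)
    (g' := fun y => p * M ^ (p - 1) - p * y ^ (p - 1)) hab
    (fun y hy => by
      refine (((hasDerivAt_id y).const_mul (p * M ^ (p - 1))).sub ((hasDerivAt_id y).rpow_const
        (p := p) (Or.inl (ha.trans_le hy.1).ne'))).congr_deriv ?_
      simp)
    (fun y hy => by
      have : y ^ (p - 1) ≤ M ^ (p - 1) :=
        rpow_le_rpow (ha.trans_le hy.1).le (hy.2.trans hb) (by linarith)
      have := mul_le_mul_of_nonneg_left this (show 0 ≤ p by linarith)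
      linarith)
  linarith

/-- If the data of one homoclinic dominate those of another one at some time, the two coincide
from then on. -/
theorem eq_of_data_le (hβ : 0 < β) (h : IsHomoclinic β v v1 w w1) (k : IsHomoclinic β u u1 x x1)
    {t₀ : ℝ} (h0 : u t₀ ≤ v t₀) (h1 : u1 t₀ ≤ v1 t₀) (h2 : x t₀ ≤ w t₀) (h3 : x1 t₀ ≤ w1 t₀) :
    (∀ t, t₀ ≤ t → v t = u t) ∧ w t₀ = x t₀ ∧ w1 t₀ = x1 t₀ := by
  obtain ⟨M, hM0, hM⟩ := h.exists_bound
  obtain ⟨N, hN0, hN⟩ := k.exists_bound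
  have hp : 1 ≤ 1 + 4 / β := by
    have : 0 < 4 / β := by positivity
    linarith
  have key := eq_zero_of_cone (z := fun t => v t - u t) (z1 := fun t => v1 t - u1 t)
    (w := fun t => w t - x t) (w1 := fun t => w1 t - x1 t) (α := β + 2) (M := M)
    (r := fun t => v t ^ (1 + 4 / β) - u t ^ (1 + 4 / β)) (t₀ := t₀)
    (K := (1 + 4 / β) * N ^ (1 + 4 / β - 1)) hβ (by positivity)
    (fun t => (h.dv t).sub (k.dv t))
    (fun t => ((h.dv1 t).sub (k.dv1 t)).congr_deriv (by ring))
    (fun t => (h.dw t).sub (k.dw t))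
    (fun t => ((h.dw1 t).sub (k.dw1 t)).congr_deriv (by ring))
    (fun t => by
      rcases le_total (u t) (v t) with hle | hle
      · rw [min_eq_right (by linarith), mul_zero]
        linarith [rpow_le_rpow (k.pos t).le hle (by linarith : 0 ≤ 1 + 4 / β)]
      · rw [min_eq_left (by linarith)]
        have := rpow_sub_rpow_le hp (h.pos t) hle (hN t)
        linarith)
    (fun t => by linarith [hM t, k.pos t])
    (by linarith) (by linarith) (by linarith) (by linarith)
  obtain ⟨k1, k2, k3⟩ := key
  exact ⟨fun t ht => by linarith [k1 t ht], by linarith, by linarith⟩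

/-- Two homoclinics whose phase curves `(v, v')` touch at the same time coincide. -/
theorem eq_of_touch (hβ : 0 < β) (h : IsHomoclinic β v v1 w w1) (k : IsHomoclinic β u u1 x x1)
    {t₀ : ℝ} (h0 : v t₀ = u t₀) (h1 : v1 t₀ = u1 t₀) : ∀ t, v t = u t := by
  have key : ∀ {v v1 w w1 u u1 x x1 : ℝ → ℝ} {t₀ : ℝ}, IsHomoclinic β v v1 w w1 →
      IsHomoclinic β u u1 x x1 → v t₀ = u t₀ → v1 t₀ = u1 t₀ → x t₀ ≤ w t₀ → x1 t₀ ≤ w1 t₀ →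
      ∀ t, v t = u t := by
    intro v v1 w w1 u u1 x x1 t₀ h k h0 h1 h2 h3 t
    obtain ⟨e1, e2, e3⟩ := h.eq_of_data_le hβ k h0.ge h1.ge h2 h3
    rcases le_total t₀ t with ht | ht
    · exact e1 t ht
    · have := (h.reflect.eq_of_data_le hβ k.reflect (t₀ := -t₀) (by simp [h0]) (by simp [h1])
        (by simp [e2]) (by simp [e3])).1 (-t) (by linarith)
      simpa using this
  have key' : ∀ {v v1 w w1 u u1 x x1 : ℝ → ℝ} {t₀ : ℝ}, IsHomoclinic β v v1 w w1 →
      IsHomoclinic β u u1 x x1 → v t₀ = u t₀ → v1 t₀ = u1 t₀ → x t₀ ≤ w t₀ →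
      ∀ t, v t = u t := by
    intro v v1 w w1 u u1 x x1 t₀ h k h0 h1 h2 t
    rcases le_total (x1 t₀) (w1 t₀) with h3 | h3
    · exact key h k h0 h1 h2 h3 t
    · have := key h.reflect k.reflect (t₀ := -t₀) (by simpa using h0) (by simpa using h1)
        (by simpa using h2) (by simpa using h3) (-t)
      simpa using this
  intro t
  rcases le_total (x t₀) (w t₀) with h2 | h2
  · exact key' h k h0 h1 h2 t
  · exact (key' k h h0.symm h1.symm h2 t).symm

theorem tendsto_deriv_atBot (hβ : 0 < β) (h : IsHomoclinic β v v1 w w1) :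
    Tendsto v1 atBot (nhds 0) := by
  have h1 : Tendsto (fun t => β * v t) atBot (nhds 0) := by simpa using h.bot.const_mul β
  have h2 : Tendsto (fun t => -(β * v t)) atBot (nhds 0) := by simpa using h1.neg
  exact tendsto_of_tendsto_of_tendsto_of_le_of_le h2 h1 (h.neg_le_deriv hβ) (h.deriv_le hβ)

theorem tendsto_rpow_atBot (h : IsHomoclinic β v v1 w w1) {q : ℝ} (hq : 0 < q) :
    Tendsto (fun t => v t ^ q) atBot (nhds 0) := by
  have := h.bot.rpow_const (p := q) (Or.inr hq.le)
  rwa [zero_rpow hq.ne'] at this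

/-- Near `-∞`, a homoclinic is nondecreasing and `v'² ≥ β² v² - D v ^ (2 + 1 / β)`. -/
theorem exists_deriv_sq_ge (hβ : 0 < β) (h : IsHomoclinic β v v1 w w1) :
    ∃ D t₁, 0 < D ∧ ∀ t, t ≤ t₁ →
      0 ≤ v1 t ∧ β ^ 2 * v t ^ 2 - D * (v t ^ 2 * v t ^ (1 / β)) ≤ v1 t ^ 2 := by
  obtain ⟨C, hC0, hC⟩ := h.exists_le_w hβ
  have hlim : Tendsto (fun t => C * v t ^ (1 / β)) atBot (nhds 0) := by
    simpa using (h.tendsto_rpow_atBot (one_div_pos.2 hβ)).const_mul C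
  obtain ⟨t₁, ht₁⟩ := eventually_atBot.1 (hlim.eventually (gt_mem_nhds (show 0 < β ^ 2 by positivity)))
  have hmul : ∀ t, v t ^ (1 + 1 / β) = v t * v t ^ (1 / β) := fun t => by
    rw [rpow_add (h.pos t), rpow_one]
  have hv1 : ∀ t, t ≤ t₁ → 0 ≤ v1 t := by
    intro t ht
    refine le_of_tendsto (h.tendsto_deriv_atBot hβ) ?_
    filter_upwards [eventually_le_atBot t] with s hs
    refine le_of_hasDerivAt_nonneg hs (fun r _ => h.dv1 r) fun r hr => ?_
    have e1 := hC r
    have e2 := ht₁ r (hr.2.trans ht)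
    have e3 := h.pos r
    rw [hmul] at e1
    nlinarith
  set D := 2 * C / (2 + 1 / β) with hD
  have hDC : D * (2 + 1 / β) = 2 * C := div_mul_cancel₀ _ (by positivity)
  refine ⟨D, t₁, by positivity, fun t ht => ⟨hv1 t ht, ?_⟩⟩
  have hmul2 : ∀ t, v t ^ (2 + 1 / β) = v t ^ 2 * v t ^ (1 / β) := fun t => by
    rw [rpow_add (h.pos t), rpow_two]
  suffices hJ : 0 ≤ v1 t ^ 2 - β ^ 2 * v t ^ 2 + D * v t ^ (2 + 1 / β) by
    rw [hmul2] at hJ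
    linarith
  have hJlim : Tendsto (fun t => v1 t ^ 2 - β ^ 2 * v t ^ 2 + D * v t ^ (2 + 1 / β)) atBot
      (nhds 0) := by
    have l1 := (h.tendsto_deriv_atBot hβ).pow 2
    have l2 := (h.bot.pow 2).const_mul (β ^ 2)
    have l3 := (h.tendsto_rpow_atBot (show 0 < 2 + 1 / β by positivity)).const_mul D
    simpa using (l1.sub l2).add l3
  refine le_of_tendsto hJlim ?_
  filter_upwards [eventually_le_atBot t] with s hs
  refine le_of_hasDerivAt_nonneg (g := fun t => v1 t ^ 2 - β ^ 2 * v t ^ 2 + D * v t ^ (2 + 1 / β))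
    (g' := fun t => 2 * v1 t * (w t + C * v t ^ (1 + 1 / β))) hs
    (fun r _ => ?_) fun r hr => ?_
  · refine ((((h.dv1 r).pow 2).sub (((h.dv r).pow 2).const_mul (β ^ 2))).add
      (((h.dv r).rpow_const (p := 2 + 1 / β) (Or.inl (h.pos r).ne')).const_mul D)).congr_deriv ?_
    rw [show 2 + 1 / β - 1 = 1 + 1 / β by ring]
    simp only [Nat.cast_ofNat, Nat.add_one_sub_one, pow_one]
    linear_combination (v1 r * v r ^ (1 + 1 / β)) * hDC
  · have := hv1 r (hr.2.trans ht)
    have := hC r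
    exact mul_nonneg (by positivity) (by linarith)

/-- The profile `(v / c) ^ (-1 / β)`, which is `2 cosh` for the explicit solution. -/
noncomputable def profile (β c : ℝ) (v : ℝ → ℝ) (t : ℝ) : ℝ := (v t / c) ^ (-(1 / β))

/-- The derivative of `profile`. -/
noncomputable def profileDeriv (β c : ℝ) (v v1 : ℝ → ℝ) (t : ℝ) : ℝ :=
  -(profile β c v t * (v1 t / (β * v t)))

variable {c : ℝ}

theorem profile_pos (hc : 0 < c) (h : IsHomoclinic β v v1 w w1) (t : ℝ) : 0 < profile β c v t :=
  rpow_pos_of_pos (div_pos (h.pos t) hc) _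

theorem profile_rpow (hβ : 0 < β) (hc : 0 < c) (h : IsHomoclinic β v v1 w w1) (t : ℝ) :
    v t = c * profile β c v t ^ (-β) := by
  have := div_pos (h.pos t) hc
  rw [profile, ← rpow_mul this.le, show -(1 / β) * -β = 1 by field_simp, rpow_one]
  field_simp

theorem hasDerivAt_profile (hβ : 0 < β) (hc : 0 < c) (h : IsHomoclinic β v v1 w w1) (t : ℝ) :
    HasDerivAt (profile β c v) (profileDeriv β c v v1 t) t := by
  have hv := h.pos t
  have := div_pos hv hc
  refine (((h.dv t).div_const c).rpow_const (p := -(1 / β)) (Or.inl this.ne')).congr_deriv ?_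
  rw [profileDeriv, profile, rpow_sub_one this.ne']
  field_simp

theorem continuous_profileDeriv (hβ : 0 < β) (hc : 0 < c) (h : IsHomoclinic β v v1 w w1) :
    Continuous (profileDeriv β c v v1) := by
  have c0 : Continuous v := continuous_iff_continuousAt.2 fun t => (h.dv t).continuousAt
  have c1 : Continuous v1 := continuous_iff_continuousAt.2 fun t => (h.dv1 t).continuousAt
  have c2 : Continuous (profile β c v) :=
    continuous_iff_continuousAt.2 fun t => (h.hasDerivAt_profile hβ hc t).continuousAt
  exact (c2.mul (c1.div (continuous_const.mul c0) fun t => (mul_pos hβ (h.pos t)).ne')).neg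

theorem tendsto_profile_atBot (hβ : 0 < β) (hc : 0 < c) (h : IsHomoclinic β v v1 w w1) :
    Tendsto (profile β c v) atBot atTop := by
  have h1 : Tendsto (fun t => v t / c) atBot (nhdsWithin 0 (Ioi 0)) := by
    refine tendsto_nhdsWithin_iff.2 ⟨by simpa using h.bot.div_const c, Eventually.of_forall fun t => ?_⟩
    exact div_pos (h.pos t) hc
  exact (tendsto_rpow_neg_nhdsGT_zero (by simpa using hβ)).comp h1

/-- `v` behaves like a positive multiple of `e^{β t}` at `-∞`. -/
theorem exists_tendsto_profile_mul_exp (hβ : 0 < β) (hc : 0 < c) (h : IsHomoclinic β v v1 w w1) :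
    ∃ l, 0 < l ∧ Tendsto (fun t => profile β c v t * exp t) atBot (nhds l) := by
  obtain ⟨D, t₁, hD0, hD⟩ := h.exists_deriv_sq_ge hβ
  have hφ := h.profile_pos hc
  have hρ : ∀ t, v1 t / (β * v t) ≤ 1 := fun t =>
    (div_le_one (mul_pos hβ (h.pos t))).2 (h.deriv_le hβ t)
  have hmono : Monotone fun t => profile β c v t * exp t := by
    intro a b hab
    refine le_of_hasDerivAt_nonneg (g := fun t => profile β c v t * exp t) hab
      (fun t _ => (h.hasDerivAt_profile hβ hc t).mul (hasDerivAt_exp t)) fun t _ => ?_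
    rw [profileDeriv, ← add_mul]
    exact mul_nonneg (by nlinarith [hφ t, hρ t]) (exp_pos t).le
  have hlim := tendsto_atBot_ciInf hmono ⟨0, by
    rintro _ ⟨t, rfl⟩
    exact (mul_pos (hφ t) (exp_pos t)).le⟩
  refine ⟨_, ?_, hlim⟩
  set E := D * c ^ (1 / β) / β ^ 2 with hE
  have hE0 : 0 < E := by positivity
  have hbound : ∀ t, t ≤ t₁ → profile β c v t + profileDeriv β c v v1 t ≤ E := by
    intro t ht
    obtain ⟨e1, e2⟩ := hD t ht
    have hv := h.pos t
    set ρ := v1 t / (β * v t) with hρd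
    have e3 : 0 ≤ ρ := by positivity
    have e4 : v1 t = ρ * (β * v t) := by rw [hρd]; field_simp
    have e5 : profile β c v t * v t ^ (1 / β) = c ^ (1 / β) := by
      rw [profile, rpow_neg (div_pos hv hc).le, div_rpow hv.le hc.le]
      have : 0 < v t ^ (1 / β) := rpow_pos_of_pos hv _
      field_simp
    have e6 : 1 - ρ ^ 2 ≤ D * v t ^ (1 / β) / β ^ 2 := by
      rw [le_div_iff₀ (by positivity)]
      rw [e4] at e2
      have : 0 < v t ^ 2 := by positivity
      by_contra! hcon
      nlinarith
    have e7 : profile β c v t * (1 - ρ ^ 2) ≤ E := by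
      refine (mul_le_mul_of_nonneg_left e6 (hφ t).le).trans (le_of_eq ?_)
      rw [hE, ← e5]
      ring
    have e8 := hρ t
    rw [profileDeriv]
    have := hφ t
    have : 0 ≤ profile β c v t * (ρ * (1 - ρ)) :=
      mul_nonneg (hφ t).le (mul_nonneg e3 (by linarith))
    nlinarith
  obtain ⟨t₂, ht₂, ht₂'⟩ := ((eventually_le_atBot t₁).and
    ((h.tendsto_profile_atBot hβ hc).eventually (eventually_gt_atTop E))).exists
  refine lt_of_lt_of_le (mul_pos (sub_pos.2 ht₂') (exp_pos t₂)) (ge_of_tendsto hlim ?_)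
  filter_upwards [eventually_le_atBot t₂] with s hs
  have := le_of_hasDerivAt_nonneg (g := fun t => -((profile β c v t - E) * exp t)) hs
    (fun t _ => (((h.hasDerivAt_profile hβ hc t).sub_const E).mul (hasDerivAt_exp t)).neg)
    fun t ht => by
      have := hbound t (ht.2.trans ht₂)
      have := exp_pos t
      nlinarith
  have := mul_pos hE0 (exp_pos s)
  linarith

theorem _root_.Filter.Tendsto.nonneg_of_forall_le {g : ℝ → ℝ} (hg : Tendsto g atBot (nhds 0))
    {t : ℝ} (h : ∀ s, s ≤ t → g s ≤ g t) : 0 ≤ g t :=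
  le_of_tendsto hg ((eventually_le_atBot t).mono h)

theorem tendsto_exp_const_mul_atBot {κ : ℝ} (hκ : 0 < κ) :
    Tendsto (fun t => exp (κ * t)) atBot (nhds 0) :=
  tendsto_exp_atBot.comp (tendsto_id.const_mul_atBot hκ)

theorem tendsto_mul_exp_atBot {g : ℝ → ℝ} {κ N : ℝ} (hκ : 0 < κ) (hg : ∀ t, |g t| ≤ N) :
    Tendsto (fun t => g t * exp (κ * t)) atBot (nhds 0) := by
  have h1 : Tendsto (fun t => N * exp (κ * t)) atBot (nhds 0) := by
    simpa using (tendsto_exp_const_mul_atBot hκ).const_mul N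
  refine squeeze_zero_norm (fun t => ?_) h1
  rw [norm_mul, norm_eq_abs, norm_of_nonneg (exp_pos _).le]
  exact mul_le_mul_of_nonneg_right (hg t) (exp_pos _).le

/-- Two homoclinics which are ordered near `-∞` and have the same leading coefficient of
`e^{β t}` there coincide. -/
theorem eq_of_ordered (hβ : 0 < β) (h : IsHomoclinic β v v1 w w1) (k : IsHomoclinic β u u1 x x1)
    {t₁ : ℝ} (hle : ∀ t, t ≤ t₁ → u t ≤ v t)
    (hlim : Tendsto (fun t => (v t - u t) * exp (-β * t)) atBot (nhds 0)) : ∀ t, v t = u t := by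
  have hα : 0 < β + 2 := by linarith
  obtain ⟨Nv, hNv⟩ := h.exists_abs_w_le hβ
  obtain ⟨Nu, hNu⟩ := k.exists_abs_w_le hβ
  obtain ⟨Pv, hPv⟩ := h.exists_abs_w1_le hβ
  obtain ⟨Pu, hPu⟩ := k.exists_abs_w1_le hβ
  obtain ⟨Mv, -, hMv⟩ := h.exists_bound
  obtain ⟨Mu, -, hMu⟩ := k.exists_bound
  have hlimY : Tendsto (fun t => ((w1 t - x1 t) - (β + 2) * (w t - x t)) * exp ((β + 2) * t)) atBot
      (nhds 0) := by
    refine tendsto_mul_exp_atBot (N := Pv + Pu + (β + 2) * (Nv + Nu)) hα fun t => ?_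
    refine (abs_sub _ _).trans ?_
    rw [abs_mul, abs_of_pos hα]
    have e1 := (abs_sub (w1 t) (x1 t)).trans (add_le_add (hPv t) (hPu t))
    have e2 := (abs_sub (w t) (x t)).trans (add_le_add (hNv t) (hNu t))
    have := mul_le_mul_of_nonneg_left e2 hα.le
    linarith
  have hlimX : Tendsto (fun t => ((v1 t - u1 t) - β * (v t - u t)) * exp (β * t)) atBot
      (nhds 0) := by
    refine tendsto_mul_exp_atBot (N := 2 * β * (Mv + Mu)) hβ fun t => ?_
    have e1 := h.deriv_le hβ t
    have e2 := h.neg_le_deriv hβ t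
    have e3 := k.deriv_le hβ t
    have e4 := k.neg_le_deriv hβ t
    have e5 := mul_le_mul_of_nonneg_left (hMv t) hβ.le
    have e6 := mul_le_mul_of_nonneg_left (hMu t) hβ.le
    have e7 := mul_pos hβ (h.pos t)
    have e8 := mul_pos hβ (k.pos t)
    rw [abs_le]
    constructor <;> linarith
  have hy : ∀ t, t ≤ t₁ → 0 ≤ (w1 t - x1 t) - (β + 2) * (w t - x t) := by
    intro t ht
    refine nonneg_of_mul_nonneg_left (hlimY.nonneg_of_forall_le fun s hs => ?_)
      (exp_pos ((β + 2) * t))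
    refine le_of_hasDerivAt_nonneg
      (g := fun t => ((w1 t - x1 t) - (β + 2) * (w t - x t)) * exp ((β + 2) * t))
      (g' := fun t => (v t ^ (1 + 4 / β) - u t ^ (1 + 4 / β)) * exp ((β + 2) * t)) hs
      (fun r _ => ?_) fun r hr => ?_
    · refine ((((h.dw1 r).sub (k.dw1 r)).sub (((h.dw r).sub (k.dw r)).const_mul (β + 2))).mul
        (hasDerivAt_exp_const_mul (β + 2) r)).congr_deriv ?_
      simp
      ring
    · exact mul_nonneg (sub_nonneg.2 (rpow_le_rpow (k.pos r).le (hle r (hr.2.trans ht))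
        (by positivity))) (exp_pos _).le
  by_cases hw : ∃ t₂, t₂ ≤ t₁ ∧ w t₂ - x t₂ ≤ 0
  · obtain ⟨t₂, ht₂, hw⟩ := hw
    have hw' : ∀ t, t ≤ t₂ → w t - x t ≤ 0 := by
      intro t ht
      have := le_of_hasDerivAt_nonneg (g := fun t => (w t - x t) * exp (-(β + 2) * t))
        (g' := fun t => ((w1 t - x1 t) - (β + 2) * (w t - x t)) * exp (-(β + 2) * t)) ht
        (fun r _ => by
          refine (((h.dw r).sub (k.dw r)).mul
            (hasDerivAt_exp_const_mul (-(β + 2)) r)).congr_deriv ?_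
          simp
          ring)
        (fun r hr => mul_nonneg (hy r (hr.2.trans ht₂)) (exp_pos _).le)
      have e1 := mul_nonpos_of_nonpos_of_nonneg hw (exp_pos (-(β + 2) * t₂)).le
      exact nonpos_of_mul_nonpos_left (this.trans e1) (exp_pos _)
    have hx' : ∀ t, t ≤ t₂ → (v1 t - u1 t) - β * (v t - u t) ≤ 0 := by
      intro t ht
      have hl := hlimX.neg
      rw [neg_zero] at hl
      have := hl.nonneg_of_forall_le (t := t) fun s hs =>
        le_of_hasDerivAt_nonneg
          (g := fun t => -(((v1 t - u1 t) - β * (v t - u t)) * exp (β * t)))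
          (g' := fun t => -(w t - x t) * exp (β * t)) hs
          (fun r _ => by
            refine ((((h.dv1 r).sub (k.dv1 r)).sub (((h.dv r).sub (k.dv r)).const_mul β)).mul
              (hasDerivAt_exp_const_mul β r)).neg.congr_deriv ?_
            simp
            ring)
          (fun r hr => mul_nonneg (by linarith [hw' r (hr.2.trans ht)]) (exp_pos _).le)
      exact nonpos_of_mul_nonpos_left (neg_nonneg.1 this) (exp_pos _)
    have hz' : ∀ t, t ≤ t₂ → v t = u t := by
      intro t ht
      have hl := hlim.neg
      rw [neg_zero] at hl
      have := hl.nonneg_of_forall_le (t := t) fun s hs =>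
        le_of_hasDerivAt_nonneg
          (g := fun t => -((v t - u t) * exp (-β * t)))
          (g' := fun t => -((v1 t - u1 t) - β * (v t - u t)) * exp (-β * t)) hs
          (fun r _ => by
            refine (((h.dv r).sub (k.dv r)).mul
              (hasDerivAt_exp_const_mul (-β) r)).neg.congr_deriv ?_
            simp
            ring)
          (fun r hr => mul_nonneg (by linarith [hx' r (hr.2.trans ht)]) (exp_pos _).le)
      have e1 := nonpos_of_mul_nonpos_left (neg_nonneg.1 this) (exp_pos _)
      linarith [hle t (ht.trans ht₂)]
    refine h.eq_of_touch hβ k (hz' (t₂ - 1) (by linarith)) ?_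
    refine (h.dv (t₂ - 1)).unique ((k.dv (t₂ - 1)).congr_of_eventuallyEq ?_)
    filter_upwards [Iio_mem_nhds (show t₂ - 1 < t₂ by linarith)] with t ht
    exact hz' t (mem_Iio.1 ht).le
  · push Not at hw
    have hx' : 0 ≤ (v1 t₁ - u1 t₁) - β * (v t₁ - u t₁) := by
      have := hlimX.nonneg_of_forall_le (t := t₁) fun s hs =>
        le_of_hasDerivAt_nonneg
          (g := fun t => ((v1 t - u1 t) - β * (v t - u t)) * exp (β * t))
          (g' := fun t => (w t - x t) * exp (β * t)) hs
          (fun r _ => by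
            refine ((((h.dv1 r).sub (k.dv1 r)).sub (((h.dv r).sub (k.dv r)).const_mul β)).mul
              (hasDerivAt_exp_const_mul β r)).congr_deriv ?_
            simp
            ring)
          (fun r hr => mul_nonneg (hw r hr.2).le (exp_pos _).le)
      exact nonneg_of_mul_nonneg_left this (exp_pos _)
    have e1 := hw t₁ le_rfl
    have e2 := mul_nonneg hβ.le (sub_nonneg.2 (hle t₁ le_rfl))
    have e3 := mul_pos hα e1
    have := (h.eq_of_data_le hβ k (t₀ := t₁) (hle t₁ le_rfl) (by linarith) (by linarith)
      (by linarith [hy t₁ le_rfl])).2.1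
    linarith

end IsHomoclinic

theorem two_cosh (s : ℝ) : 2 * cosh s = exp s + exp (-s) := by
  rw [cosh_eq]; ring

theorem hasDerivAt_two_cosh_sub (T t : ℝ) :
    HasDerivAt (fun t => 2 * cosh (t - T)) (2 * sinh (t - T)) t :=
  ((((hasDerivAt_id t).sub_const T).cosh).const_mul 2).congr_deriv (by simp)

theorem hasDerivAt_cosh_rpow (γ T t : ℝ) :
    HasDerivAt (fun t => (2 * cosh (t - T)) ^ (-γ))
      (-γ * (2 * cosh (t - T)) ^ (-γ - 1) * (2 * sinh (t - T))) t := by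
  have hpos : 0 < 2 * cosh (t - T) := mul_pos two_pos (cosh_pos _)
  refine ((hasDerivAt_two_cosh_sub T t).rpow_const (p := -γ) (Or.inl hpos.ne')).congr_deriv ?_
  ring

theorem hasDerivAt_deriv_cosh_rpow (γ T t : ℝ) :
    HasDerivAt (fun t => -γ * (2 * cosh (t - T)) ^ (-γ - 1) * (2 * sinh (t - T)))
      (γ ^ 2 * (2 * cosh (t - T)) ^ (-γ) - 4 * γ * (γ + 1) * (2 * cosh (t - T)) ^ (-(γ + 2))) t := by
  have hpos : 0 < 2 * cosh (t - T) := mul_pos two_pos (cosh_pos _)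
  have hs : HasDerivAt (fun t => 2 * sinh (t - T)) (2 * cosh (t - T)) t :=
    ((((hasDerivAt_id t).sub_const T).sinh).const_mul 2).congr_deriv (by simp)
  refine ((((hasDerivAt_two_cosh_sub T t).rpow_const (p := -γ - 1)
    (Or.inl hpos.ne')).const_mul (-γ)).mul hs).congr_deriv ?_
  have hsq := cosh_sq (t - T)
  set a := (2 * cosh (t - T)) ^ (-(γ + 2)) with ha
  have r1 : (2 * cosh (t - T)) ^ (-γ - 1 - 1) = a := by rw [ha]; congr 1; ring
  have r2 : (2 * cosh (t - T)) ^ (-γ - 1) = a * (2 * cosh (t - T)) := by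
    rw [ha, ← rpow_add_one hpos.ne']; congr 1; ring
  have r3 : (2 * cosh (t - T)) ^ (-γ) = a * (2 * cosh (t - T)) * (2 * cosh (t - T)) := by
    rw [← r2, ← rpow_add_one hpos.ne']; congr 1; ring
  rw [r1, r2, r3]
  linear_combination (-4 * γ * (γ + 1) * a) * hsq

theorem tendsto_cosh_rpow {β : ℝ} (hβ : 0 < β) (T : ℝ) {l : Filter ℝ}
    (hl : Tendsto (fun t => 2 * cosh (t - T)) l atTop) :
    Tendsto (fun t => (2 * cosh (t - T)) ^ (-β)) l (nhds 0) :=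
  (tendsto_rpow_neg_atTop hβ).comp hl

theorem isHomoclinic_cosh {β c : ℝ} (hβ : 0 < β) (hc : 0 < c)
    (hcβ : c ^ (4 / β) = 16 * (β * (β + 1) * (β + 2) * (β + 3))) (T : ℝ) :
    IsHomoclinic β (fun t => c * (2 * cosh (t - T)) ^ (-β))
      (fun t => c * (-β * (2 * cosh (t - T)) ^ (-β - 1) * (2 * sinh (t - T))))
      (fun t => -4 * β * (β + 1) * c * (2 * cosh (t - T)) ^ (-(β + 2)))
      (fun t => -4 * β * (β + 1) * c *
        (-(β + 2) * (2 * cosh (t - T)) ^ (-(β + 2) - 1) * (2 * sinh (t - T)))) where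
  dv t := (hasDerivAt_cosh_rpow β T t).const_mul c
  dv1 t := ((hasDerivAt_deriv_cosh_rpow β T t).const_mul c).congr_deriv (by ring)
  dw t := (hasDerivAt_cosh_rpow (β + 2) T t).const_mul _
  dw1 t := by
    refine ((hasDerivAt_deriv_cosh_rpow (β + 2) T t).const_mul _).congr_deriv ?_
    have hpos : 0 < 2 * cosh (t - T) := mul_pos two_pos (cosh_pos _)
    rw [mul_rpow hc.le (rpow_pos_of_pos hpos _).le, ← rpow_mul hpos.le, rpow_add hc, rpow_one, hcβ,
      show -β * (1 + 4 / β) = -(β + 2 + 2) by field_simp; ring]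
    ring
  pos t := mul_pos hc (rpow_pos_of_pos (mul_pos two_pos (cosh_pos _)) _)
  top := by
    have : Tendsto (fun t => 2 * cosh (t - T)) atTop atTop := by
      refine tendsto_atTop_mono (fun t => ?_)
        (tendsto_exp_atTop.comp (tendsto_atTop_add_const_right _ (-T) tendsto_id))
      rw [two_cosh]
      have := exp_pos (-(t - T))
      simp only [Function.comp, id, ← sub_eq_add_neg]
      linarith
    simpa using (tendsto_cosh_rpow hβ T this).const_mul c
  bot := by
    have : Tendsto (fun t => 2 * cosh (t - T)) atBot atTop := by
      refine tendsto_atTop_mono (fun t => ?_)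
        (tendsto_exp_atTop.comp (tendsto_atTop_add_const_right _ T tendsto_neg_atBot_atTop))
      rw [two_cosh]
      have := exp_pos (t - T)
      simp only [Function.comp, show -(t - T) = -t + T by ring]
      linarith
    simpa using (tendsto_cosh_rpow hβ T this).const_mul c

theorem hasDerivAt_add_sqrt_mul_exp {φ : ℝ → ℝ} {φ' t : ℝ} (hφ : HasDerivAt φ φ' t)
    (h2 : 2 < φ t) :
    HasDerivAt (fun s => (φ s + √(φ s ^ 2 - 4)) * exp s)
      ((φ t + √(φ t ^ 2 - 4)) * exp t / √(φ t ^ 2 - 4) * (φ' + √(φ t ^ 2 - 4))) t := by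
  have hpos : 0 < φ t ^ 2 - 4 := by nlinarith
  have hs : √(φ t ^ 2 - 4) ≠ 0 := (sqrt_pos.2 hpos).ne'
  refine ((hφ.add (((hφ.pow 2).sub_const 4).sqrt hpos.ne')).mul (hasDerivAt_exp t)).congr_deriv ?_
  simp only [Pi.add_apply, Pi.pow_apply, Nat.cast_ofNat, Nat.add_one_sub_one, pow_one]
  field_simp
  ring

theorem tendsto_add_sqrt_mul_exp {φ : ℝ → ℝ} {l : ℝ} (hl : 0 < l)
    (h : Tendsto (fun t => φ t * exp t) atBot (nhds l)) :
    Tendsto (fun t => (φ t + √(φ t ^ 2 - 4)) * exp t) atBot (nhds (2 * l)) := by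
  have h1 : Tendsto (fun t => φ t * exp t + √((φ t * exp t) ^ 2 - 4 * exp t ^ 2)) atBot
      (nhds (l + √(l ^ 2 - 4 * 0 ^ 2))) :=
    h.add ((h.pow 2).sub ((tendsto_exp_atBot.pow 2).const_mul 4)).sqrt
  rw [zero_pow two_ne_zero, mul_zero, sub_zero, sqrt_sq hl.le, ← two_mul] at h1
  refine h1.congr fun t => ?_
  rw [show (φ t * exp t) ^ 2 - 4 * exp t ^ 2 = (φ t ^ 2 - 4) * exp t ^ 2 by ring,
    sqrt_mul' _ (sq_nonneg _), sqrt_sq (exp_pos t).le]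
  ring

theorem two_cosh_le_of_exp_le {φ s : ℝ} (hs : 0 ≤ s) (h2 : 2 < φ)
    (h : 2 * exp s ≤ φ + √(φ ^ 2 - 4)) : 2 * cosh s ≤ φ := by
  have hq : √(φ ^ 2 - 4) ^ 2 = φ ^ 2 - 4 := sq_sqrt (by nlinarith)
  have h1 : 1 ≤ exp s := one_le_exp hs
  have hinv : exp s * exp (-s) = 1 := by rw [← exp_add]; simp
  have hneg := exp_pos (-s)
  rw [two_cosh]
  by_contra! hc
  have h3 : exp s - exp (-s) < √(φ ^ 2 - 4) := by linarith
  have h4 : 0 ≤ exp s - exp (-s) := by nlinarith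
  nlinarith

theorem le_two_cosh_of_le_exp {φ s : ℝ} (h2 : 2 < φ)
    (h : φ + √(φ ^ 2 - 4) ≤ 2 * exp s) : φ ≤ 2 * cosh s := by
  have hq : √(φ ^ 2 - 4) ^ 2 = φ ^ 2 - 4 := sq_sqrt (by nlinarith)
  have hq0 := sqrt_nonneg (φ ^ 2 - 4)
  have hinv : exp s * exp (-s) = 1 := by rw [← exp_add]; simp
  have hneg := exp_pos (-s)
  rw [two_cosh]
  by_contra! hc
  have h3 : √(φ ^ 2 - 4) < exp s - exp (-s) := by linarith
  nlinarith

namespace IsHomoclinic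

variable {β c : ℝ} {v v1 w w1 : ℝ → ℝ}

theorem tendsto_mul_exp_of_profile {φ : ℝ → ℝ} (hφ : ∀ t, 0 < φ t) {l : ℝ}
    (hl : 0 < l) (h : Tendsto (fun t => φ t * exp t) atBot (nhds l)) :
    Tendsto (fun t => c * φ t ^ (-β) * exp (-β * t)) atBot (nhds (c * l ^ (-β))) := by
  refine ((h.rpow_const (p := -β) (Or.inl hl.ne')).const_mul c).congr fun t => ?_
  rw [mul_rpow (hφ t).le (exp_pos t).le, ← exp_mul]
  ring_nf

/-- A homoclinic whose phase curve stays on one side of that of the explicit solution is a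
translate of it. -/
theorem exists_eq_cosh_of_one_sided (hβ : 0 < β) (hc : 0 < c)
    (hcβ : c ^ (4 / β) = 16 * (β * (β + 1) * (β + 2) * (β + 3)))
    (h : IsHomoclinic β v v1 w w1)
    (hside : (∀ t, profileDeriv β c v v1 t ^ 2 ≤ profile β c v t ^ 2 - 4) ∨
      ∀ t, profile β c v t ^ 2 - 4 ≤ profileDeriv β c v v1 t ^ 2) :
    ∃ T, ∀ t, v t = c * (2 * cosh (t - T)) ^ (-β) := by
  obtain ⟨l, hl, hlim⟩ := h.exists_tendsto_profile_mul_exp hβ hc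
  obtain ⟨D, t₀, -, hD⟩ := h.exists_deriv_sq_ge hβ
  set T := log l with hT
  have hexpT : exp T = l := exp_log hl
  have k := isHomoclinic_cosh hβ hc hcβ T
  refine ⟨T, ?_⟩
  obtain ⟨t₁, ht₁⟩ := eventually_atBot.1 ((eventually_le_atBot t₀).and ((eventually_le_atBot T).and
    ((h.tendsto_profile_atBot hβ hc).eventually (eventually_gt_atTop 2))))
  have hpd : ∀ t, t ≤ t₁ → profileDeriv β c v v1 t ≤ 0 := by
    intro t ht
    have e1 := (hD t (ht₁ t ht).1).1
    have e2 := h.profile_pos hc t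
    have e3 := h.pos t
    rw [profileDeriv, neg_nonpos]
    positivity
  have hX := tendsto_add_sqrt_mul_exp hl hlim
  have hcosh : Tendsto (fun t => 2 * cosh (t - T) * exp t) atBot (nhds l) := by
    have e : Tendsto (fun t => exp t ^ 2 * exp (-T) + exp T) atBot
        (nhds (0 ^ 2 * exp (-T) + exp T)) :=
      ((tendsto_exp_atBot.pow 2).mul_const _).add_const _
    rw [zero_pow two_ne_zero, zero_mul, zero_add, hexpT] at e
    refine e.congr fun t => ?_
    rw [two_cosh, add_mul, ← exp_add, ← exp_add, ← hexpT, ← exp_nat_mul, ← exp_add]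
    congr 2
    · push_cast; ring
    · ring
  have l1 := tendsto_mul_exp_of_profile (β := β) (c := c) (h.profile_pos hc) hl hlim
  have l2 := tendsto_mul_exp_of_profile (β := β) (c := c)
    (fun t => mul_pos two_pos (cosh_pos (t - T))) hl hcosh
  have hdiff : Tendsto (fun t => (v t - c * (2 * cosh (t - T)) ^ (-β)) * exp (-β * t)) atBot
      (nhds 0) := by
    have := l1.sub l2
    rw [sub_self] at this
    refine this.congr fun t => ?_
    rw [← h.profile_rpow hβ hc t]
    ring
  have hanti : ∀ {a b : ℝ}, 0 < a → a ≤ b → c * b ^ (-β) ≤ c * a ^ (-β) := fun ha hab =>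
    mul_le_mul_of_nonneg_left (rpow_le_rpow_of_nonpos ha hab (by linarith)) hc.le
  have hexp : ∀ t, 2 * exp (T - t) * exp t = 2 * l := fun t => by
    rw [mul_assoc, ← exp_add, sub_add_cancel, hexpT]
  rcases hside with hside | hside
  · have hle : ∀ t, t ≤ t₁ → v t ≤ c * (2 * cosh (t - T)) ^ (-β) := by
      intro t ht
      obtain ⟨-, e1, e2⟩ := ht₁ t ht
      rw [h.profile_rpow hβ hc t]
      refine hanti (mul_pos two_pos (cosh_pos (t - T))) ?_
      rw [← cosh_neg, neg_sub]
      refine two_cosh_le_of_exp_le (by linarith) e2 (le_of_mul_le_mul_right ?_ (exp_pos t))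
      rw [hexp]
      refine le_of_tendsto hX ?_
      filter_upwards [eventually_le_atBot t] with s hs
      refine le_of_hasDerivAt_nonneg hs (fun r hr => hasDerivAt_add_sqrt_mul_exp
        (h.hasDerivAt_profile hβ hc r) (ht₁ r (hr.2.trans ht)).2.2) fun r hr => ?_
      have := h.profile_pos hc r
      have := abs_le_sqrt (hside r)
      have := neg_abs_le (profileDeriv β c v v1 r)
      exact mul_nonneg (by positivity) (by linarith)
    have hdiff' : Tendsto (fun t => (c * (2 * cosh (t - T)) ^ (-β) - v t) * exp (-β * t)) atBot
        (nhds 0) := by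
      have := hdiff.neg
      rw [neg_zero] at this
      refine this.congr fun t => ?_
      ring
    exact fun t => (k.eq_of_ordered hβ h hle hdiff' t).symm
  · refine h.eq_of_ordered hβ k (t₁ := t₁) (fun t ht => ?_) hdiff
    obtain ⟨-, e1, e2⟩ := ht₁ t ht
    rw [h.profile_rpow hβ hc t]
    refine hanti (h.profile_pos hc t) ?_
    rw [← cosh_neg, neg_sub]
    refine le_two_cosh_of_le_exp e2 (le_of_mul_le_mul_right ?_ (exp_pos t))
    rw [hexp]
    refine ge_of_tendsto hX ?_
    filter_upwards [eventually_le_atBot t] with s hs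
    refine neg_le_neg_iff.1 (le_of_hasDerivAt_nonneg
      (g := fun t => -((profile β c v t + √(profile β c v t ^ 2 - 4)) * exp t)) hs (fun r hr => (hasDerivAt_add_sqrt_mul_exp
      (h.hasDerivAt_profile hβ hc r) (ht₁ r (hr.2.trans ht)).2.2).neg) fun r hr => ?_)
    have := h.profile_pos hc r
    have e3 : √(profile β c v r ^ 2 - 4) ≤ -profileDeriv β c v v1 r := by
      refine sqrt_le_iff.2 ⟨by linarith [hpd r (hr.2.trans ht)], ?_⟩
      rw [neg_sq]
      exact hside r
    rw [← mul_neg]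
    exact mul_nonneg (by positivity) (by linarith)

/-- Every homoclinic is a translate of the explicit one. -/
theorem exists_eq_cosh (hβ : 0 < β) (hc : 0 < c)
    (hcβ : c ^ (4 / β) = 16 * (β * (β + 1) * (β + 2) * (β + 3)))
    (h : IsHomoclinic β v v1 w w1) :
    ∃ T, ∀ t, v t = c * (2 * cosh (t - T)) ^ (-β) := by
  have hcont : Continuous fun t => profileDeriv β c v v1 t ^ 2 - (profile β c v t ^ 2 - 4) := by
    have c1 := h.continuous_profileDeriv hβ hc
    have c2 : Continuous (profile β c v) :=
      continuous_iff_continuousAt.2 fun t => (h.hasDerivAt_profile hβ hc t).continuousAt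
    fun_prop
  by_cases htouch : ∃ t, profileDeriv β c v v1 t ^ 2 - (profile β c v t ^ 2 - 4) = 0
  · obtain ⟨t, ht⟩ := htouch
    have hφ := h.profile_pos hc t
    have hrep := h.profile_rpow hβ hc t
    set s := arsinh (profileDeriv β c v v1 t / 2) with hs
    have hsinh : 2 * sinh s = profileDeriv β c v v1 t := by
      rw [hs, sinh_arsinh]; ring
    have hcosh : 2 * cosh s = profile β c v t := by
      have h1 := cosh_sq s
      have h2 := cosh_pos s
      have h3 : (2 * cosh s) ^ 2 = profile β c v t ^ 2 := by
        rw [← hsinh] at ht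
        linear_combination 4 * h1 + ht
      exact (pow_left_inj₀ (by positivity) hφ.le two_ne_zero).1 h3
    refine ⟨t - s, h.eq_of_touch hβ (isHomoclinic_cosh hβ hc hcβ (t - s)) (t₀ := t) ?_ ?_⟩
    · simpa only [sub_sub_cancel, hcosh] using hrep
    · simp only [sub_sub_cancel, hcosh, hsinh]
      have hv := h.pos t
      rw [rpow_sub_one hφ.ne', profileDeriv]
      field_simp
      linear_combination v1 t * hrep
  · push Not at htouch
    refine h.exists_eq_cosh_of_one_sided hβ hc hcβ ?_
    by_contra! hcon
    obtain ⟨⟨a, ha⟩, b, hb⟩ := hcon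
    obtain ⟨t, ht⟩ := mem_range_of_exists_le_of_exists_ge hcont (c := 0)
      ⟨b, by linarith⟩ ⟨a, by linarith⟩
    exact htouch t ht

end IsHomoclinic

theorem isHomoclinic_of_ode (n : ℕ) (hn : 5 ≤ n) (v : ℝ → ℝ) (hreg : ContDiff ℝ 4 v)
    (hode : ∀ t : ℝ, iteratedDeriv 4 v t - Paper.A n * iteratedDeriv 2 v t
      - Paper.f n (v t) = 0)
    (hpos : ∀ t : ℝ, 0 < v t)
    (hlim : Tendsto v atTop (nhds 0) ∧ Tendsto v atBot (nhds 0)) :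
    IsHomoclinic (((n : ℝ) - 4) / 2) v (iteratedDeriv 1 v)
      (fun t => iteratedDeriv 2 v t - (((n : ℝ) - 4) / 2) ^ 2 * v t)
      (fun t => iteratedDeriv 3 v t - (((n : ℝ) - 4) / 2) ^ 2 * iteratedDeriv 1 v t) := by
  have hn' : (5 : ℝ) ≤ n := by exact_mod_cast hn
  have hd : ∀ m : ℕ, m < 4 → ∀ t, HasDerivAt (iteratedDeriv m v) (iteratedDeriv (m + 1) v t) t := by
    intro m hm t
    rw [iteratedDeriv_succ]
    exact ((hreg.differentiable_iteratedDeriv m (by exact_mod_cast hm)) t).hasDerivAt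
  have hd0 : ∀ t, HasDerivAt v (iteratedDeriv 1 v t) t := by
    intro t
    simpa using hd 0 (by norm_num) t
  refine ⟨hd0, fun t => (hd 1 (by norm_num) t).congr_deriv (by ring), fun t =>
    (hd 2 (by norm_num) t).sub ((hd0 t).const_mul _), fun t => ?_, hpos, hlim.1, hlim.2⟩
  refine ((hd 3 (by norm_num) t).sub ((hd 1 (by norm_num) t).const_mul _)).congr_deriv ?_
  have h := hode t
  have hv := hpos t
  have hne : (n : ℝ) - 4 ≠ 0 := by linarith
  have hf : Paper.f n (v t) = v t ^ (1 + 4 / (((n : ℝ) - 4) / 2)) - Paper.B n * v t := by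
    rw [Paper.f, abs_of_pos hv, ← rpow_add_one hv.ne', Paper.p]
    congr 2
    field_simp
    ring
  rw [hf, Paper.A, Paper.B] at h
  norm_num
  linear_combination h

theorem c_rpow (n : ℕ) (hn : 5 ≤ n) :
    Paper.c n ^ (4 / (((n : ℝ) - 4) / 2)) = 16 * ((((n : ℝ) - 4) / 2) * (((n : ℝ) - 4) / 2 + 1) *
      (((n : ℝ) - 4) / 2 + 2) * (((n : ℝ) - 4) / 2 + 3)) := by
  have hn' : (5 : ℝ) ≤ n := by exact_mod_cast hn
  have hne : (n : ℝ) - 4 ≠ 0 := by linarith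
  have h0 : 0 ≤ ((n : ℝ) - 4) * ((n : ℝ) - 2) * (n : ℝ) * ((n : ℝ) + 2) := by
    have h1 : 0 ≤ (n : ℝ) - 4 := by linarith
    have h2 : 0 ≤ (n : ℝ) - 2 := by linarith
    positivity
  rw [Paper.c, ← rpow_mul h0,
    show ((n : ℝ) - 4) / 8 * (4 / (((n : ℝ) - 4) / 2)) = 1 by field_simp; norm_num, rpow_one]
  ring

theorem c_pos (n : ℕ) (hn : 5 ≤ n) : 0 < Paper.c n := by
  have hn' : (5 : ℝ) ≤ n := by exact_mod_cast hn
  have h1 : 0 < (n : ℝ) - 4 := by linarith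
  have h2 : 0 < (n : ℝ) - 2 := by linarith
  rw [Paper.c]
  positivity

end Homoclinic

/-- **Corollary 9.** Every positive `C⁴` solution of `v'''' - A v'' - f(v) = 0` tending to `0`
at `±∞` is a translate of `t ↦ c_n (2 cosh t)^(-(n-4)/2)`. -/
theorem homoclinic_is_cosh (n : ℕ) (hn : 5 ≤ n) (v : ℝ → ℝ)
    (hreg : ContDiff ℝ 4 v)
    (hode : ∀ t : ℝ, iteratedDeriv 4 v t - Paper.A n * iteratedDeriv 2 v t
      - Paper.f n (v t) = 0)
    (hpos : ∀ t : ℝ, 0 < v t)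
    (hlim : Tendsto v atTop (nhds 0) ∧ Tendsto v atBot (nhds 0)) :
    ∃ T : ℝ, ∀ t : ℝ,
      v t = Paper.c n * (2 * Real.cosh (t - T)) ^ (-(((n : ℝ) - 4) / 2)) := by
  have hn' : (5 : ℝ) ≤ n := by exact_mod_cast hn
  exact (Homoclinic.isHomoclinic_of_ode n hn v hreg hode hpos hlim).exists_eq_cosh
    (by linarith) (Homoclinic.c_pos n hn) (Homoclinic.c_rpow n hn)
end

section
/- Let v ∈ C⁴(ℝ) be a solution of the ODE v'''' − A·v'' − f(v) = 0 on all of ℝ. Then v is bounded, i.e. there exists M > 0 with |v(t)| ≤ M for all t ∈ ℝ. -/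
open Real Filter

namespace FourthOrderODE

/-- A solution of `v⁗ = a v″ + |v|^q v - b v`, given together with its first three
derivatives. -/
structure IsSolution (q a b : ℝ) (v v₁ v₂ v₃ : ℝ → ℝ) : Prop where
  d₀ : ∀ t, HasDerivAt v (v₁ t) t
  d₁ : ∀ t, HasDerivAt v₁ (v₂ t) t
  d₂ : ∀ t, HasDerivAt v₂ (v₃ t) t
  d₃ : ∀ t, HasDerivAt v₃ (a * v₂ t + (|v t| ^ q * v t - b * v t)) t

namespace IsSolution

variable {q a b : ℝ} {v v₁ v₂ v₃ : ℝ → ℝ}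

lemma neg (h : IsSolution q a b v v₁ v₂ v₃) :
    IsSolution q a b (fun t => -v t) (fun t => -v₁ t) (fun t => -v₂ t) (fun t => -v₃ t) where
  d₀ t := (h.d₀ t).neg
  d₁ t := (h.d₁ t).neg
  d₂ t := (h.d₂ t).neg
  d₃ t := by
    refine (h.d₃ t).neg.congr_deriv ?_
    rw [abs_neg]
    ring

lemma reflect (h : IsSolution q a b v v₁ v₂ v₃) :
    IsSolution q a b (fun t => v (-t)) (fun t => -v₁ (-t)) (fun t => v₂ (-t))
      (fun t => -v₃ (-t)) where
  d₀ t := ((h.d₀ (-t)).scomp t (hasDerivAt_neg t)).congr_deriv (by simp)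
  d₁ t := ((h.d₁ (-t)).scomp t (hasDerivAt_neg t)).neg.congr_deriv (by simp)
  d₂ t := ((h.d₂ (-t)).scomp t (hasDerivAt_neg t)).congr_deriv (by simp)
  d₃ t := ((h.d₃ (-t)).scomp t (hasDerivAt_neg t)).neg.congr_deriv (by simp)

end IsSolution

lemma le_of_hasDerivAt_le {g g' φ φ' : ℝ → ℝ} {s : ℝ} (hg : ∀ x, HasDerivAt g (g' x) x)
    (hφ : ∀ x, HasDerivAt φ (φ' x) x) (hle : ∀ x, s ≤ x → φ' x ≤ g' x) (hs : φ s ≤ g s)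
    {x : ℝ} (hx : s ≤ x) : φ x ≤ g x := by
  have hd : ∀ x, HasDerivAt (fun y => g y - φ y) (g' x - φ' x) x := fun x => (hg x).sub (hφ x)
  have hm : MonotoneOn (fun y => g y - φ y) (Set.Ici s) := by
    refine monotoneOn_of_deriv_nonneg (convex_Ici s)
      (fun x _ => (hd x).continuousAt.continuousWithinAt)
      (fun x _ => (hd x).differentiableAt.differentiableWithinAt) fun x hx => ?_
    rw [interior_Ici] at hx
    rw [(hd x).deriv]
    linarith [hle x (le_of_lt hx)]
  have := hm Set.self_mem_Ici hx hx
  simp only at this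
  linarith

lemma hasDerivAt_mul_sub_pow (K s : ℝ) (m : ℕ) (x : ℝ) :
    HasDerivAt (fun y => K * (y - s) ^ (m + 1)) (K * (m + 1) * (x - s) ^ m) x := by
  refine ((((hasDerivAt_id x).sub_const s).pow (m + 1)).const_mul K).congr_deriv ?_
  simp
  ring

lemma exists_rpow_ge {q : ℝ} (hq : 0 < q) (C : ℝ) :
    ∃ V : ℝ, 1 ≤ V ∧ ∀ x, V ≤ x → C ≤ x ^ q := by
  obtain ⟨V, hV⟩ := eventually_atTop.1 ((tendsto_rpow_atTop hq).eventually_ge_atTop C)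
  exact ⟨max V 1, le_max_right _ _, fun x hx => hV x ((le_max_left _ _).trans hx)⟩

namespace IsSolution

variable {q a b : ℝ} {v v₁ v₂ v₃ : ℝ → ℝ}

lemma energy_const (h : IsSolution q a b v v₁ v₂ v₃) (hq : 0 < q) :
    ∃ E : ℝ, ∀ t, -v₃ t * v₁ t + v₂ t ^ 2 / 2 + a / 2 * v₁ t ^ 2
      + (|v t| ^ (q + 2) / (q + 2) - b / 2 * v t ^ 2) = E := by
  set e : ℝ → ℝ := fun t => -v₃ t * v₁ t + v₂ t ^ 2 / 2 + a / 2 * v₁ t ^ 2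
      + (|v t| ^ (q + 2) / (q + 2) - b / 2 * v t ^ 2)
  have hd : ∀ t, HasDerivAt e 0 t := by
    intro t
    have h1 := ((h.d₃ t).neg.mul (h.d₁ t))
    have h2 := ((h.d₂ t).pow 2).div_const 2
    have h3 := ((h.d₁ t).pow 2).const_mul (a / 2)
    have h4 := ((hasDerivAt_abs_rpow (v t) (by linarith : 1 < q + 2)).comp t (h.d₀ t)).div_const
      (q + 2)
    have h5 := ((h.d₀ t).pow 2).const_mul (b / 2)
    refine (((h1.add h2).add h3).add (h4.sub h5)).congr_deriv ?_
    have : q + 2 ≠ 0 := by linarith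
    rw [show q + 2 - 2 = q by ring]
    simp
    field_simp
    ring
  refine ⟨e 0, fun t => ?_⟩
  exact is_const_of_deriv_eq_zero (fun t => (hd t).differentiableAt) (fun t => (hd t).deriv) t 0

lemma critical_bound (h : IsSolution q a b v v₁ v₂ v₃) (hq : 0 < q) :
    ∃ M : ℝ, ∀ t, v₁ t = 0 → |v t| ≤ M := by
  obtain ⟨E, hE⟩ := h.energy_const hq
  obtain ⟨V, hV1, hV⟩ := exists_rpow_ge hq ((q + 2) * (b / 2 + 1))
  refine ⟨max V E, fun t ht => ?_⟩
  rcases le_or_gt |v t| V with hle | hlt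
  · exact hle.trans (le_max_left _ _)
  · refine le_trans ?_ (le_max_right _ _)
    have h1 : 1 < |v t| := lt_of_le_of_lt hV1 hlt
    have h2 := hV _ hlt.le
    have h3 := hE t
    rw [ht, rpow_add (by linarith), rpow_two, sq_abs] at h3
    have h4 : |v t| ≤ v t ^ 2 := by rw [← sq_abs]; nlinarith
    have h5 : (b / 2 + 1) * v t ^ 2 ≤ |v t| ^ q * v t ^ 2 / (q + 2) := by
      rw [le_div_iff₀ (by linarith)]
      nlinarith [mul_le_mul_of_nonneg_right h2 (sq_nonneg (v t))]
    nlinarith [sq_nonneg (v₂ t)]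

/-- A solution that is increasing near `+∞` and tends to `+∞` has, from some time on,
nonnegative derivatives and a fourth derivative of size at least `v ^ (q + 1) / 2`. -/
lemma eventually_convex (h : IsSolution q a b v v₁ v₂ v₃) (hq : 0 < q) (ha : 0 < a)
    (hv : ∀ K : ℝ, ∃ t, ∀ s, t ≤ s → K ≤ v s ∧ 0 ≤ v₁ s) :
    ∃ T, ∀ t, T ≤ t → 1 ≤ v t ∧ 0 ≤ v₁ t ∧ 0 ≤ v₂ t ∧ 0 ≤ v₃ t ∧
      v t ^ q * v t / 2 ≤ a * v₂ t + (|v t| ^ q * v t - b * v t) := by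
  obtain ⟨V, hV1, hV⟩ := exists_rpow_ge hq (2 * b + 2)
  obtain ⟨V', -, hV'⟩ := exists_rpow_ge hq 2
  obtain ⟨T₁, hT₁⟩ := hv (max V V')
  have hf : ∀ t, T₁ ≤ t → 1 ≤ v t ^ q * v t / 2 ∧
      v t ^ q * v t / 2 ≤ |v t| ^ q * v t - b * v t := by
    intro t ht
    have h1 := (hT₁ t ht).1
    have h2 := hV _ ((le_max_left _ _).trans h1)
    have h2' := hV' _ ((le_max_right _ _).trans h1)
    have h3 : 1 ≤ v t := hV1.trans ((le_max_left _ _).trans h1)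
    rw [abs_of_pos (by linarith)]
    constructor <;> nlinarith
  have hline : ∀ (c d s x : ℝ), HasDerivAt (fun y => c + d * (y - s)) d x := by
    intro c d s x
    simpa using (((hasDerivAt_id x).sub_const s).const_mul d).const_add c
  have h3 : ∀ t, T₁ ≤ t → (v₃ T₁ - a * v₁ T₁) + 1 * (t - T₁) ≤ v₃ t - a * v₁ t := by
    intro t ht
    refine le_of_hasDerivAt_le (fun x => (h.d₃ x).sub ((h.d₁ x).const_mul a))
      (hline _ 1 T₁) (fun x hx => ?_) ?_ ht
    · linarith [hf x hx]
    · simp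
  set T₂ := max T₁ (T₁ + 1 - (v₃ T₁ - a * v₁ T₁))
  have h3' : ∀ t, T₂ ≤ t → 1 ≤ v₃ t := by
    intro t ht
    have e1 := (le_max_left _ _).trans ht
    have e2 := (le_max_right _ _).trans ht
    have e3 := h3 t e1
    nlinarith [mul_nonneg ha.le (hT₁ t e1).2]
  have h2 : ∀ t, T₂ ≤ t → v₂ T₂ + 1 * (t - T₂) ≤ v₂ t := by
    intro t ht
    refine le_of_hasDerivAt_le h.d₂ (hline _ 1 T₂) h3' ?_ ht
    simp
  refine ⟨max T₂ (T₂ - v₂ T₂), fun t ht => ?_⟩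
  have e2 : T₂ ≤ t := (le_max_left _ _).trans ht
  have e3 : T₂ - v₂ T₂ ≤ t := (le_max_right _ _).trans ht
  have e1 : T₁ ≤ t := (le_max_left _ _).trans e2
  have p2 : 0 ≤ v₂ t := by linarith [h2 t e2]
  refine ⟨hV1.trans ((le_max_left _ _).trans (hT₁ t e1).1), (hT₁ t e1).2, p2,
    by linarith [h3' t e2], ?_⟩
  nlinarith [(hf t e1).2, mul_nonneg ha.le p2]

/-- A superlinear solution cannot be increasing to `+∞` on a half-line: it would blow up in
finite time. -/
lemma not_increasing_to_infinity (h : IsSolution q a b v v₁ v₂ v₃) (hq : 0 < q) (ha : 0 < a)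
    (hv : ∀ K : ℝ, ∃ t, ∀ s, t ≤ s → K ≤ v s ∧ 0 ≤ v₁ s) : False := by
  obtain ⟨T, hT⟩ := h.eventually_convex hq ha hv
  have hmono : ∀ s t, T ≤ s → s ≤ t → v s ≤ v t := by
    intro s t hs hst
    exact le_of_hasDerivAt_le h.d₀ (fun x => hasDerivAt_const x (v s))
      (fun x hx => (hT x (hs.trans hx)).2.1) le_rfl hst
  have hstep : ∀ t W d, T ≤ t → 1 ≤ W → W ≤ v t → 0 ≤ d →
      W + W ^ q * W * d ^ 4 / 48 ≤ v (t + d) := by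
    intro t W d ht hW hWt hd
    set K := W ^ q * W / 2 with hK
    have c3 : ∀ x, t ≤ x → K * (x - t) ^ (0 + 1) ≤ v₃ x := fun x hx => by
      refine le_of_hasDerivAt_le h.d₃ (hasDerivAt_mul_sub_pow K t 0) (fun y hy => ?_) ?_ hx
      · refine le_trans ?_ (hT y (ht.trans hy)).2.2.2.2
        have hWy : W ≤ v y := hWt.trans (hmono t y ht hy)
        have : W ^ q * W ≤ v y ^ q * v y :=
          mul_le_mul (rpow_le_rpow (by linarith) hWy hq.le) hWy (by linarith)
            (rpow_nonneg (by linarith) q)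
        simp
        linarith
      · simpa using (hT t ht).2.2.2.1
    have c2 : ∀ x, t ≤ x → K / 2 * (x - t) ^ (1 + 1) ≤ v₂ x := fun x hx => by
      refine le_of_hasDerivAt_le h.d₂ (hasDerivAt_mul_sub_pow (K / 2) t 1) (fun y hy => ?_) ?_ hx
      · refine le_trans (le_of_eq ?_) (c3 y hy)
        push_cast
        ring
      · simpa using (hT t ht).2.2.1
    have c1 : ∀ x, t ≤ x → K / 6 * (x - t) ^ (2 + 1) ≤ v₁ x := fun x hx => by
      refine le_of_hasDerivAt_le h.d₁ (hasDerivAt_mul_sub_pow (K / 6) t 2) (fun y hy => ?_) ?_ hx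
      · refine le_trans (le_of_eq ?_) (c2 y hy)
        push_cast
        ring
      · simpa using (hT t ht).2.1
    have c0 : ∀ x, t ≤ x → W + K / 24 * (x - t) ^ (3 + 1) ≤ v x := fun x hx => by
      refine le_of_hasDerivAt_le h.d₀
        (fun y => (hasDerivAt_mul_sub_pow (K / 24) t 3 y).const_add W) (fun y hy => ?_) ?_ hx
      · refine le_trans (le_of_eq ?_) (c1 y hy)
        push_cast
        ring
      · simpa using hWt
    refine le_trans (le_of_eq ?_) (c0 (t + d) (by linarith))
    rw [hK]
    ring
  set r : ℝ := 2 ^ (-q / 4) with hr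
  have hr0 : 0 < r := by positivity
  have hr1 : r < 1 := rpow_lt_one_of_one_lt_of_neg (by norm_num) (by linarith)
  have hr4 : (2 : ℝ) ^ q * r ^ 4 = 1 := by
    rw [hr, ← rpow_natCast, ← rpow_mul (by norm_num), ← rpow_add (by norm_num)]
    norm_num
  have hk : ∀ k : ℕ, (2 : ℝ) ^ k ≤ v (T + 3 * ∑ i ∈ Finset.range k, r ^ i) := by
    intro k
    induction k with
    | zero => simpa using (hT T le_rfl).1
    | succ k ih =>
      have hs : 0 ≤ ∑ i ∈ Finset.range k, r ^ i := by positivity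
      have := hstep (T + 3 * ∑ i ∈ Finset.range k, r ^ i) (2 ^ k) (3 * r ^ k) (by linarith)
        (one_le_pow₀ (by norm_num)) ih (by positivity)
      rw [Finset.sum_range_succ, mul_add, ← add_assoc]
      refine le_trans ?_ this
      have e : ((2 : ℝ) ^ k) ^ q * (r ^ k) ^ 4 = 1 := by
        rw [← rpow_pow_comm (by norm_num), ← pow_mul, mul_comm k 4, pow_mul, ← mul_pow, hr4,
          one_pow]
      have e' : ((2 : ℝ) ^ k) ^ q * 2 ^ k * (3 * r ^ k) ^ 4 / 48
          = (((2 : ℝ) ^ k) ^ q * (r ^ k) ^ 4) * (2 ^ k * (81 / 48)) := by ring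
      rw [e', e, pow_succ]
      have : (0 : ℝ) < 2 ^ k := by positivity
      linarith
  obtain ⟨k, hk'⟩ := pow_unbounded_of_one_lt (v (T + 3 * (1 - r)⁻¹)) (one_lt_two)
  have hs : 0 ≤ ∑ i ∈ Finset.range k, r ^ i := by positivity
  have hle : ∑ i ∈ Finset.range k, r ^ i ≤ (1 - r)⁻¹ := by
    rw [← tsum_geometric_of_lt_one hr0.le hr1]
    exact (summable_geometric_of_lt_one hr0.le hr1).sum_le_tsum _ fun i _ => by positivity
  have := hmono (T + 3 * ∑ i ∈ Finset.range k, r ^ i) (T + 3 * (1 - r)⁻¹) (by linarith)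
    (by linarith)
  linarith [hk k]

end IsSolution

lemma deriv_pos_of_critical_le {v v₁ : ℝ → ℝ} (hd : ∀ t, HasDerivAt v (v₁ t) t) {M t s : ℝ}
    (hM : ∀ x, v₁ x = 0 → v x ≤ M) (ht : 0 ≤ t) (h₀ : v 0 < v t) (hMt : M < v t)
    (hs : t ≤ s) : 0 < v₁ s := by
  obtain ⟨m, hm, hmax⟩ := isCompact_Icc.exists_isMaxOn
    (Set.nonempty_Icc.2 (ht.trans hs)) (fun x _ => (hd x).continuousAt.continuousWithinAt)
  have hmt : v t ≤ v m := hmax ⟨ht, hs⟩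
  have hne : v₁ m ≠ 0 := fun h => by linarith [hM m h]
  have hm0 : 0 < m := lt_of_le_of_ne hm.1 fun h => by rw [← h] at hmt; linarith
  have hms : m = s := by
    by_contra hms
    exact hne ((hmax.isLocalMax (Icc_mem_nhds hm0 (lt_of_le_of_ne hm.2 hms))).hasDerivAt_eq_zero
      (hd m))
  subst hms
  refine lt_of_le_of_ne ?_ (Ne.symm hne)
  have hl : Tendsto (slope v m) (nhdsWithin m (Set.Iio m)) (nhds (v₁ m)) :=
    (hasDerivAt_iff_tendsto_slope.1 (hd m)).mono_left
      (nhdsWithin_mono _ fun x hx => ne_of_lt hx)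
  refine ge_of_tendsto hl ?_
  filter_upwards [Ioo_mem_nhdsLT hm0] with x hx
  rw [slope_def_field]
  exact div_nonneg_of_nonpos (sub_nonpos.2 (hmax ⟨hx.1.le, hx.2.le⟩)) (sub_nonpos.2 hx.2.le)

namespace IsSolution

variable {q a b : ℝ} {v v₁ v₂ v₃ : ℝ → ℝ}

lemma bddAbove_nonneg (h : IsSolution q a b v v₁ v₂ v₃) (hq : 0 < q) (ha : 0 < a) :
    ∃ K : ℝ, ∀ t, 0 ≤ t → v t ≤ K := by
  by_contra! hK
  obtain ⟨M, hM⟩ := h.critical_bound hq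
  refine h.not_increasing_to_infinity hq ha fun K => ?_
  obtain ⟨t, ht, hlt⟩ := hK (max K (max M (v 0)))
  simp only [max_lt_iff] at hlt
  have hpos : ∀ s, t ≤ s → 0 ≤ v₁ s := fun s hs => (deriv_pos_of_critical_le h.d₀
    (fun x hx => (le_abs_self _).trans (hM x hx)) ht hlt.2.2 hlt.2.1 hs).le
  refine ⟨t, fun s hs => ⟨?_, hpos s hs⟩⟩
  exact le_of_hasDerivAt_le h.d₀ (fun x => hasDerivAt_const x K) hpos hlt.1.le hs

lemma bounded_nonneg (h : IsSolution q a b v v₁ v₂ v₃) (hq : 0 < q) (ha : 0 < a) :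
    ∃ K : ℝ, ∀ t, 0 ≤ t → |v t| ≤ K := by
  obtain ⟨K, hK⟩ := h.bddAbove_nonneg hq ha
  obtain ⟨L, hL⟩ := h.neg.bddAbove_nonneg hq ha
  exact ⟨max K L, fun t ht => abs_le'.2
    ⟨(hK t ht).trans (le_max_left _ _), (hL t ht).trans (le_max_right _ _)⟩⟩

theorem bounded (h : IsSolution q a b v v₁ v₂ v₃) (hq : 0 < q) (ha : 0 < a) :
    ∃ M : ℝ, 0 < M ∧ ∀ t, |v t| ≤ M := by
  obtain ⟨K, hK⟩ := h.bounded_nonneg hq ha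
  obtain ⟨L, hL⟩ := h.reflect.bounded_nonneg hq ha
  refine ⟨max 1 (max K L), lt_max_of_lt_left one_pos, fun t => ?_⟩
  refine le_trans ?_ (le_max_right _ _)
  rcases le_total 0 t with ht | ht
  · exact (hK t ht).trans (le_max_left _ _)
  · have := hL (-t) (by linarith)
    rw [neg_neg] at this
    exact this.trans (le_max_right _ _)

end IsSolution

end FourthOrderODE

/-- **Lemma 10.** Every `C⁴` solution of `v'''' - A v'' - f(v) = 0` on all of `ℝ`
is bounded. -/
theorem global_solutions_are_bounded (n : ℕ) (hn : 5 ≤ n) (v : ℝ → ℝ)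
    (hreg : ContDiff ℝ 4 v)
    (hode : ∀ t : ℝ, iteratedDeriv 4 v t - Paper.A n * iteratedDeriv 2 v t
      - Paper.f n (v t) = 0) :
    ∃ M : ℝ, 0 < M ∧ ∀ t : ℝ, |v t| ≤ M := by
  have hn' : (5 : ℝ) ≤ n := by exact_mod_cast hn
  have hq : 0 < Paper.p n - 1 := by
    rw [Paper.p, sub_pos, lt_div_iff₀ (by linarith)]
    linarith
  have ha : 0 < Paper.A n := by
    rw [Paper.A]
    nlinarith
  have hd : ∀ k : ℕ, k < 4 → ∀ t, HasDerivAt (iteratedDeriv k v) (iteratedDeriv (k + 1) v t) t := by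
    intro k hk t
    rw [iteratedDeriv_succ]
    exact (hreg.differentiable_iteratedDeriv k (by exact_mod_cast hk) t).hasDerivAt
  refine FourthOrderODE.IsSolution.bounded (q := Paper.p n - 1) (a := Paper.A n) (b := Paper.B n)
    (v₁ := iteratedDeriv 1 v) (v₂ := iteratedDeriv 2 v) (v₃ := iteratedDeriv 3 v)
    ⟨fun t => ?_, hd 1 (by norm_num), hd 2 (by norm_num), fun t => ?_⟩ hq ha
  · simpa using hd 0 (by norm_num) t
  · convert hd 3 (by norm_num) t using 1
    have := hode t
    rw [Paper.f] at this
    linarith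
end
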